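/- arXiv:2007.10325 — 6 statements merged into one kernel-verified Lean document; each statement's English description precedes it below -/
import Mathlib

section
/- Let ψ:[a,b]→ℝ be an increasing C¹ function with ψ'(t)≠0 for all t∈[a,b], let σ:[a,b]→ℝ be continuous, and let α>0, β>0. Then for every t∈[a,b], (1/Γ(α))∫_a^t ψ'(s)(ψ(t)−ψ(s))^{α−1} [(1/Γ(β))∫_a^s ψ'(u)(ψ(s)−ψ(u))^{β−1} σ(u) du] ds = (1/Γ(α+β))∫_a^t ψ'(s)(ψ(t)−ψ(s))^{α+β−1} σ(s) ds; that is, the ψ-Riemann–Liouville fractional integrals satisfy the semigroup law I^{α;ψ}I^{β;ψ}σ = I^{α+β;ψ}σ. -/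
open MeasureTheory intervalIntegral Set

/-- The Euler beta integral over `[x, T]`, expressed through the Gamma function. -/
theorem integral_rpow_sub_mul_rpow_sub {α β x T : ℝ} (hα : 0 < α) (hβ : 0 < β) (hxT : x < T) :
    ∫ y in x..T, (T - y) ^ (α - 1) * (y - x) ^ (β - 1) =
      (T - x) ^ (α + β - 1) * ProbabilityTheory.beta α β := by
  have hL : 0 < T - x := sub_pos.2 hxT
  have hshift : ∫ y in x..T, (T - y) ^ (α - 1) * (y - x) ^ (β - 1) =
      ∫ y in (0 : ℝ)..(T - x), y ^ (β - 1) * (T - x - y) ^ (α - 1) := by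
    have h := intervalIntegral.integral_comp_sub_right (a := x) (b := T)
      (fun y : ℝ => y ^ (β - 1) * (T - x - y) ^ (α - 1)) x
    rw [sub_self] at h
    rw [← h]
    refine intervalIntegral.integral_congr fun y _ => ?_
    simp only [sub_sub_sub_cancel_right]
    ring
  have hbeta : ProbabilityTheory.beta α β = ProbabilityTheory.beta β α := by
    simp only [ProbabilityTheory.beta, add_comm, mul_comm]
  have hcast : ((∫ y in (0 : ℝ)..(T - x), y ^ (β - 1) * (T - x - y) ^ (α - 1) : ℝ) : ℂ) =
      ((T - x : ℝ) : ℂ) ^ ((β : ℂ) + α - 1) * Complex.betaIntegral β α := by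
    rw [← Complex.betaIntegral_scaled _ _ hL, ← intervalIntegral.integral_ofReal]
    refine intervalIntegral.integral_congr fun y hy => ?_
    rw [uIcc_of_le hL.le] at hy
    simp only [Complex.ofReal_mul]
    rw [Complex.ofReal_cpow hy.1, Complex.ofReal_cpow (sub_nonneg.2 hy.2)]
    push_cast
    rfl
  have hpow : ((T - x : ℝ) : ℂ) ^ ((β : ℂ) + α - 1) = (((T - x) ^ (α + β - 1) : ℝ) : ℂ) := by
    rw [Complex.ofReal_cpow hL.le]
    push_cast
    rw [add_comm]
  rw [hshift, hbeta, ProbabilityTheory.beta_eq_betaIntegralReal β α hβ hα,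
    ← Complex.re_ofReal_mul, ← hpow, ← hcast, Complex.ofReal_re]

theorem intervalIntegrable_rpow_sub_mul_rpow_sub {α β x T : ℝ} (hα : 0 < α) (hβ : 0 < β)
    (hxT : x < T) :
    IntervalIntegrable (fun y => (T - y) ^ (α - 1) * (y - x) ^ (β - 1)) volume x T := by
  by_contra h
  have h0 := integral_rpow_sub_mul_rpow_sub hα hβ hxT
  rw [intervalIntegral.integral_undef h] at h0
  exact (mul_pos (Real.rpow_pos_of_pos (sub_pos.2 hxT) _)
    (ProbabilityTheory.beta_pos hα hβ)).ne h0

/-- The semigroup law for the classical Riemann–Liouville integral, without normalization. -/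
theorem integral_rpow_sub_mul_integral_rpow_sub {α β A T : ℝ} (hα : 0 < α) (hβ : 0 < β)
    (hAT : A ≤ T) {g : ℝ → ℝ} (hg : ContinuousOn g (Icc A T)) :
    ∫ y in A..T, (T - y) ^ (α - 1) * ∫ x in A..y, (y - x) ^ (β - 1) * g x =
      ProbabilityTheory.beta α β * ∫ x in A..T, (T - x) ^ (α + β - 1) * g x := by
  let k : ℝ × ℝ → ℝ := fun p => (T - p.1) ^ (α - 1) * (p.1 - p.2) ^ (β - 1)
  let F : ℝ → ℝ → ℝ := fun y x => {p : ℝ × ℝ | p.2 < p.1}.indicator k (y, x) * g x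
  have hF (y x : ℝ) : F y x =
      (Ioi x).indicator (fun y => (T - y) ^ (α - 1) * (y - x) ^ (β - 1)) y * g x := by
    simp only [F, k, indicator_apply, mem_ofPred_eq, mem_Ioi]
  have hInt {x : ℝ} (hx : x ∈ Ioo A T) : IntegrableOn
      ((Ioi x).indicator (fun y => (T - y) ^ (α - 1) * (y - x) ^ (β - 1))) (Ioo A T) := by
    rw [IntegrableOn, integrable_indicator_iff measurableSet_Ioi, IntegrableOn,
      Measure.restrict_restrict measurableSet_Ioi, ← IntegrableOn]
    refine ((intervalIntegrable_iff_integrableOn_Ioo_of_le hx.2.le).1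
      (intervalIntegrable_rpow_sub_mul_rpow_sub hα hβ hx.2)).mono_set fun y hy => ⟨hy.1, hy.2.2⟩
  have hval {x : ℝ} (hx : x ∈ Ioo A T) : ∫ y in Ioo A T,
      (Ioi x).indicator (fun y => (T - y) ^ (α - 1) * (y - x) ^ (β - 1)) y =
      (T - x) ^ (α + β - 1) * ProbabilityTheory.beta α β := by
    rw [← integral_rpow_sub_mul_rpow_sub hα hβ hx.2, intervalIntegral.integral_of_le hx.2.le,
      integral_Ioc_eq_integral_Ioo, setIntegral_indicator measurableSet_Ioi]
    congr 2
    ext y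
    simp only [mem_inter_iff, mem_Ioo, mem_Ioi]
    exact ⟨fun h => ⟨h.2, h.1.2⟩, fun h => ⟨⟨hx.1.trans h.1, h.2⟩, h.1⟩⟩
  have hpow : IntegrableOn (fun x => (T - x) ^ (α + β - 1) * |g x|) (Ioo A T) := by
    rw [← intervalIntegrable_iff_integrableOn_Ioo_of_le hAT]
    refine IntervalIntegrable.mul_continuousOn ?_ (by rw [uIcc_of_le hAT]; exact hg.abs)
    have h := (intervalIntegral.intervalIntegrable_rpow' (a := T - A) (b := 0)
      (by linarith : -1 < α + β - 1)).comp_sub_left T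
    simpa using h
  have hmeas : AEStronglyMeasurable (Function.uncurry F)
      ((volume.restrict (Ioo A T)).prod (volume.restrict (Ioo A T))) := by
    refine AEStronglyMeasurable.mul ?_ ?_
    · refine (Measurable.indicator ?_ (measurableSet_lt measurable_snd measurable_fst)
        ).aestronglyMeasurable
      fun_prop
    · exact ((hg.mono Ioo_subset_Icc_self).aestronglyMeasurable measurableSet_Ioo).comp_snd
  have hFint : Integrable (Function.uncurry F)
      ((volume.restrict (Ioo A T)).prod (volume.restrict (Ioo A T))) := by
    rw [integrable_prod_iff' hmeas]
    constructor
    · filter_upwards [ae_restrict_mem measurableSet_Ioo] with x hx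
      simp only [Function.uncurry_apply_pair, hF]
      exact (hInt hx).mul_const _
    · refine (hpow.mul_const (ProbabilityTheory.beta α β)).congr ?_
      filter_upwards [ae_restrict_mem measurableSet_Ioo] with x hx
      rw [mul_right_comm, ← hval hx, ← MeasureTheory.integral_mul_const]
      refine setIntegral_congr_fun measurableSet_Ioo fun y hy => ?_
      have h0 : 0 ≤ (Ioi x).indicator (fun y => (T - y) ^ (α - 1) * (y - x) ^ (β - 1)) y :=
        indicator_apply_nonneg fun hxy => mul_nonneg (Real.rpow_nonneg (sub_nonneg.2 hy.2.le) _)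
          (Real.rpow_nonneg (sub_nonneg.2 (le_of_lt hxy)) _)
      simp only [Function.uncurry_apply_pair, hF, norm_mul, Real.norm_eq_abs, abs_of_nonneg h0]
  rw [intervalIntegral.integral_of_le hAT, intervalIntegral.integral_of_le hAT,
    integral_Ioc_eq_integral_Ioo, integral_Ioc_eq_integral_Ioo, ← MeasureTheory.integral_const_mul]
  calc ∫ y in Ioo A T, (T - y) ^ (α - 1) * ∫ x in A..y, (y - x) ^ (β - 1) * g x
      = ∫ y in Ioo A T, ∫ x in Ioo A T, F y x := by
        refine setIntegral_congr_fun measurableSet_Ioo fun y hy => ?_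
        have hFy (x : ℝ) : F y x = (Iio y).indicator
            (fun x => (T - y) ^ (α - 1) * ((y - x) ^ (β - 1) * g x)) x := by
          simp only [F, k, indicator_apply, mem_ofPred_eq, mem_Iio, ite_mul, zero_mul, mul_assoc]
        simp only [hFy]
        rw [setIntegral_indicator measurableSet_Iio, Ioo_inter_Iio, min_eq_right hy.2.le,
          MeasureTheory.integral_const_mul, intervalIntegral.integral_of_le hy.1.le,
          integral_Ioc_eq_integral_Ioo]
    _ = ∫ x in Ioo A T, ∫ y in Ioo A T, F y x := integral_integral_swap hFint
    _ = ∫ x in Ioo A T, ProbabilityTheory.beta α β * ((T - x) ^ (α + β - 1) * g x) := by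
        refine setIntegral_congr_fun measurableSet_Ioo fun x hx => ?_
        simp only [hF]
        rw [MeasureTheory.integral_mul_const, hval hx]
        ring

/-- **Semigroup law for ψ-Riemann–Liouville fractional integrals.**
If ψ : [a,b] → ℝ is an increasing C¹ function with ψ'(t) ≠ 0 on [a,b], σ is continuous
on [a,b] and α, β > 0, then I^{α;ψ} (I^{β;ψ} σ) = I^{α+β;ψ} σ on [a,b]. -/
theorem psi_fractional_integral_semigroup
    (a b α β : ℝ) (hab : a < b) (ψ σ : ℝ → ℝ)
    (hψmono : StrictMonoOn ψ (Icc a b))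
    (hψC1 : ContDiffOn ℝ 1 ψ (Icc a b))
    (hψ' : ∀ t ∈ Icc a b, deriv ψ t ≠ 0)
    (hσ : ContinuousOn σ (Icc a b))
    (hα : 0 < α) (hβ : 0 < β) :
    ∀ t ∈ Icc a b,
      (1 / Real.Gamma α) *
        ∫ s in a..t, deriv ψ s * (ψ t - ψ s) ^ (α - 1) *
          ((1 / Real.Gamma β) * ∫ u in a..s, deriv ψ u * (ψ s - ψ u) ^ (β - 1) * σ u) =
      (1 / Real.Gamma (α + β)) *
        ∫ s in a..t, deriv ψ s * (ψ t - ψ s) ^ (α + β - 1) * σ s := by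
  intro t ht
  have hψc : ContinuousOn ψ (Icc a b) := hψC1.continuousOn
  have hderiv (s : ℝ) (hs : s ∈ Icc a b) : HasDerivAt ψ (deriv ψ s) s :=
    (differentiableAt_of_deriv_ne_zero (hψ' s hs)).hasDerivAt
  have hnonneg (s : ℝ) (hs : s ∈ Ioo a b) : 0 ≤ deriv ψ s := by
    rw [← derivWithin_of_mem_nhds (Icc_mem_nhds hs.1 hs.2)]
    exact hψmono.monotoneOn.derivWithin_nonneg
  have hsubst (h : ℝ → ℝ) (s : ℝ) (hs : s ∈ Icc a b) :
      ∫ u in a..s, deriv ψ u * h (ψ u) = ∫ x in ψ a..ψ s, h x := by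
    have hsub : Ioo (min a s) (max a s) ⊆ Ioo a b := by
      rw [min_eq_left hs.1, max_eq_right hs.1]
      exact Ioo_subset_Ioo_right hs.2
    rw [← intervalIntegral.integral_comp_mul_deriv_of_deriv_nonneg (f := ψ) (f' := deriv ψ)
      (hψc.mono (by rw [uIcc_of_le hs.1]; exact Icc_subset_Icc_right hs.2))
      (fun x hx => hderiv x (Ioo_subset_Icc_self (hsub hx)))
      (fun x hx => hnonneg x (hsub hx))]
    simp only [Function.comp_apply, mul_comm]
  let g : ℝ → ℝ := σ ∘ Function.invFunOn ψ (Icc a b)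
  have hgψ (s : ℝ) (hs : s ∈ Icc a b) : g (ψ s) = σ s := by
    simp only [g, Function.comp_apply]
    rw [hψmono.injOn.leftInvOn_invFunOn hs]
  have himage : ψ '' Icc a b = Icc (ψ a) (ψ b) :=
    hψc.image_Icc_of_monotoneOn hab.le hψmono.monotoneOn
  have hg : ContinuousOn g (Icc (ψ a) (ψ b)) := by
    rw [← himage, continuousOn_iff_continuous_domRestrict]
    let f : Icc a b → ψ '' Icc a b := (mapsTo_image ψ (Icc a b)).restrict
    have hf : Continuous f := hψc.mapsToRestrict (mapsTo_image ψ (Icc a b))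
    have hfsurj : Function.Surjective f := by
      rintro ⟨_, s, hs, rfl⟩
      exact ⟨⟨s, hs⟩, rfl⟩
    rw [(hf.isClosedMap.isQuotientMap hf hfsurj).continuous_iff]
    refine (continuousOn_iff_continuous_domRestrict.1 hσ).congr fun s => ?_
    exact (hgψ s s.2).symm
  have hσsubst (c γ s : ℝ) (hs : s ∈ Icc a b) :
      ∫ u in a..s, deriv ψ u * (c - ψ u) ^ γ * σ u =
        ∫ x in ψ a..ψ s, (c - x) ^ γ * g x := by
    rw [← hsubst (fun x => (c - x) ^ γ * g x) s hs]
    refine intervalIntegral.integral_congr fun u hu => ?_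
    rw [uIcc_of_le hs.1] at hu
    simp only [hgψ u ⟨hu.1, hu.2.trans hs.2⟩, mul_assoc]
  have houter : ∫ s in a..t, deriv ψ s * (ψ t - ψ s) ^ (α - 1) *
        ((1 / Real.Gamma β) * ∫ u in a..s, deriv ψ u * (ψ s - ψ u) ^ (β - 1) * σ u) =
      (1 / Real.Gamma β) * ∫ y in ψ a..ψ t, (ψ t - y) ^ (α - 1) *
        ∫ x in ψ a..y, (y - x) ^ (β - 1) * g x := by
    rw [← hsubst (fun y => (ψ t - y) ^ (α - 1) * ∫ x in ψ a..y, (y - x) ^ (β - 1) * g x) t ht,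
      ← intervalIntegral.integral_const_mul]
    refine intervalIntegral.integral_congr fun s hs => ?_
    rw [uIcc_of_le ht.1] at hs
    simp only [hσsubst (ψ s) (β - 1) s ⟨hs.1, hs.2.trans ht.2⟩]
    ring
  have hat : ψ a ≤ ψ t := hψmono.monotoneOn (left_mem_Icc.2 hab.le) ht ht.1
  have htb : ψ t ≤ ψ b := hψmono.monotoneOn ht (right_mem_Icc.2 hab.le) ht.2
  rw [houter, hσsubst (ψ t) (α + β - 1) t ht, integral_rpow_sub_mul_integral_rpow_sub hα hβ hat
    (hg.mono (Icc_subset_Icc_right htb)), ProbabilityTheory.beta]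
  have := (Real.Gamma_pos_of_pos hα).ne'
  have := (Real.Gamma_pos_of_pos hβ).ne'
  field_simp
end

section
/- Assume (A1): f:[0,1]×ℝ²→ℝ is continuous and there exists L₁>0 with |f(t,x₁,y₁)−f(t,x₂,y₂)| ≤ L₁(|x₁−x₂|+|y₁−y₂|) for all t∈[0,1] and x₁,x₂,y₁,y₂∈ℝ. Set M₁ = sup_{t∈[0,1]} |f(t,0,0)|. Let r>0 and let x,y:[0,1]→ℝ be continuous with ‖x‖+‖y‖ ≤ r. Then for all t∈[0,1], |T₁(x,y)(t)| ≤ (1/Γ(α+1))[ (ψ(1)−ψ(0))^α + ((λ+1)/|Δ₁|)(ψ(1)−ψ(0))^{α+1} ](L₁ r + M₁). -/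
open MeasureTheory intervalIntegral Set

/-- The sup norm of a function on `[0,1]`. -/
noncomputable def supNorm (x : ℝ → ℝ) : ℝ := ⨆ t : Set.Icc (0:ℝ) 1, |x ↑t|

/-- The operator `T₁` (and, with the parameters `(β, ξ, μ, Δ₂, g)`, the operator `T₂`)
associated with the four-point boundary value problem:
`T₁(x,y)(t) = (1/Γ(α)) ∫₀ᵗ ψ'(s)(ψ(t)−ψ(s))^{α−1} f(s,x(s),y(s)) ds
  + (1/Δ₁)[ (1/Γ(α)) ∫₀¹ ψ'(s)(ψ(1)−ψ(s))^{α−1} f(s,x(s),y(s)) ds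
  − (λ/Γ(α)) ∫₀^η ψ'(s)(ψ(η)−ψ(s))^{α−1} f(s,x(s),y(s)) ds ] (ψ(t)−ψ(0))`. -/
noncomputable def Tmap (ψ : ℝ → ℝ) (α η lam Δ : ℝ) (f : ℝ → ℝ → ℝ → ℝ)
    (x y : ℝ → ℝ) (t : ℝ) : ℝ :=
  (1 / Real.Gamma α) * (∫ s in (0:ℝ)..t, deriv ψ s * (ψ t - ψ s) ^ (α - 1) * f s (x s) (y s))
  + (1 / Δ) *
      ((1 / Real.Gamma α) *
          (∫ s in (0:ℝ)..1, deriv ψ s * (ψ 1 - ψ s) ^ (α - 1) * f s (x s) (y s))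
        - (lam / Real.Gamma α) *
          (∫ s in (0:ℝ)..η, deriv ψ s * (ψ η - ψ s) ^ (α - 1) * f s (x s) (y s)))
    * (ψ t - ψ 0)

theorem abs_le_iSup_abs_Icc {g : ℝ → ℝ} (hg : ContinuousOn g (Icc 0 1)) {s : ℝ}
    (hs : s ∈ Icc (0:ℝ) 1) : |g s| ≤ ⨆ t : Set.Icc (0:ℝ) 1, |g ↑t| := by
  obtain ⟨C, hC⟩ := isCompact_Icc.exists_bound_of_continuousOn hg
  exact le_ciSup (f := fun t : Set.Icc (0:ℝ) 1 => |g ↑t|)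
    ⟨C, by rintro _ ⟨t, rfl⟩; exact hC t t.2⟩ ⟨s, hs⟩

/-- A `ψ`-Riemann–Liouville integral of a function bounded by `C` on `[0,u]` is at most
`C (ψ u - ψ 0) ^ α / α`. -/
theorem abs_integral_deriv_mul_rpow_mul_le {ψ h : ℝ → ℝ} {α u C : ℝ} (hu : 0 ≤ u)
    (hψmono : MonotoneOn ψ (Icc 0 u)) (hψc : ContinuousOn ψ (Icc 0 u))
    (hψd : ∀ s ∈ Ioo 0 u, DifferentiableAt ℝ ψ s) (hα : 1 < α)
    (hC : ∀ s ∈ Icc 0 u, |h s| ≤ C) :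
    |∫ s in (0:ℝ)..u, deriv ψ s * (ψ u - ψ s) ^ (α - 1) * h s| ≤
      C * ((ψ u - ψ 0) ^ α / α) := by
  have hα0 : α ≠ 0 := by linarith
  have hkernel : ∀ s ∈ Ioo 0 u, 0 ≤ deriv ψ s * (ψ u - ψ s) ^ (α - 1) := fun s hs => by
    have hψu : ψ s ≤ ψ u := hψmono (Ioo_subset_Icc_self hs) (right_mem_Icc.2 hu) hs.2.le
    have hderiv : 0 ≤ deriv ψ s := by
      rw [← derivWithin_of_mem_nhds (Icc_mem_nhds hs.1 hs.2)]
      exact hψmono.derivWithin_nonneg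
    exact mul_nonneg hderiv (Real.rpow_nonneg (by linarith) _)
  have hcont : ContinuousOn (fun s => -((ψ u - ψ s) ^ α / α)) (Icc 0 u) :=
    (((continuousOn_const.sub hψc).rpow_const fun _ _ => Or.inr (by linarith)).div_const
      α).neg
  have hprim : ∀ s ∈ Ioo 0 u, HasDerivAt (fun s => -((ψ u - ψ s) ^ α / α))
      (deriv ψ s * (ψ u - ψ s) ^ (α - 1)) s := fun s hs => by
    have hd := ((((hψd s hs).hasDerivAt.const_sub (ψ u)).rpow_const (p := α)
      (Or.inr hα.le)).div_const α).neg
    exact hd.congr_deriv (by field_simp)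
  have hint : IntervalIntegrable (fun s => deriv ψ s * (ψ u - ψ s) ^ (α - 1)) volume 0 u :=
    (intervalIntegrable_iff_integrableOn_Ioc_of_le hu).2
      (integrableOn_deriv_of_nonneg hcont hprim hkernel)
  have hval := integral_eq_sub_of_hasDerivAt_of_le hu hcont hprim hint
  rw [sub_self, Real.zero_rpow hα0] at hval
  calc |∫ s in (0:ℝ)..u, deriv ψ s * (ψ u - ψ s) ^ (α - 1) * h s|
      ≤ ∫ s in (0:ℝ)..u, C * (deriv ψ s * (ψ u - ψ s) ^ (α - 1)) := by
        rw [← Real.norm_eq_abs]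
        refine norm_integral_le_of_norm_le hu ?_ (hint.const_mul C)
        filter_upwards [Measure.ae_ne volume u] with s hsu hs
        have hs' : s ∈ Ioo 0 u := ⟨hs.1, lt_of_le_of_ne hs.2 hsu⟩
        rw [norm_mul, Real.norm_of_nonneg (hkernel s hs'), mul_comm]
        exact mul_le_mul_of_nonneg_right (hC s (Ioo_subset_Icc_self hs')) (hkernel s hs')
    _ = C * ((ψ u - ψ 0) ^ α / α) := by
        rw [intervalIntegral.integral_const_mul, hval]; ring

/-- **Bound for `T₁` on the ball of radius `r`.**
Under the Lipschitz assumption (A1) on `f`, with `M₁ = sup_{t∈[0,1]} |f(t,0,0)|`, if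
`‖x‖+‖y‖ ≤ r` then `|T₁(x,y)(t)| ≤ (1/Γ(α+1))[(ψ(1)−ψ(0))^α
+ ((λ+1)/|Δ₁|)(ψ(1)−ψ(0))^{α+1}](L₁ r + M₁)` for all `t ∈ [0,1]`. -/
theorem T1_bound_on_ball
    (α η lam Δ₁ : ℝ) (ψ : ℝ → ℝ) (f : ℝ → ℝ → ℝ → ℝ)
    (hψmono : StrictMonoOn ψ (Icc 0 1))
    (hψC1 : ContDiffOn ℝ 1 ψ (Icc 0 1))
    (hψ' : ∀ t ∈ Icc (0:ℝ) 1, deriv ψ t ≠ 0)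
    (hα1 : 1 < α) (hα2 : α < 2)
    (hη0 : 0 < η) (hη1 : η < 1) (hlam : 0 < lam)
    (hΔ₁ : Δ₁ = lam * (ψ η - ψ 0) - (ψ 1 - ψ 0)) (hΔ₁0 : Δ₁ ≠ 0)
    (hfc : ContinuousOn (fun p : ℝ × ℝ × ℝ => f p.1 p.2.1 p.2.2)
      (Icc 0 1 ×ˢ (univ : Set (ℝ × ℝ))))
    (L₁ : ℝ) (hL₁ : 0 < L₁)
    (hflip : ∀ t ∈ Icc (0:ℝ) 1, ∀ x₁ y₁ x₂ y₂ : ℝ,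
      |f t x₁ y₁ - f t x₂ y₂| ≤ L₁ * (|x₁ - x₂| + |y₁ - y₂|))
    (M₁ : ℝ) (hM₁ : M₁ = ⨆ t : Set.Icc (0:ℝ) 1, |f ↑t 0 0|)
    (r : ℝ) (hr : 0 < r)
    (x y : ℝ → ℝ) (hx : ContinuousOn x (Icc 0 1)) (hy : ContinuousOn y (Icc 0 1))
    (hxyr : supNorm x + supNorm y ≤ r) :
    ∀ t ∈ Icc (0:ℝ) 1,
      |Tmap ψ α η lam Δ₁ f x y t| ≤
        (1 / Real.Gamma (α + 1)) *
          ((ψ 1 - ψ 0) ^ α + ((lam + 1) / |Δ₁|) * (ψ 1 - ψ 0) ^ (α + 1)) *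
          (L₁ * r + M₁) := by
  intro t ht
  have h0 : (0:ℝ) ∈ Icc (0:ℝ) 1 := left_mem_Icc.2 zero_le_one
  have h1 : (1:ℝ) ∈ Icc (0:ℝ) 1 := right_mem_Icc.2 zero_le_one
  have hf0 : ContinuousOn (fun s => f s 0 0) (Icc 0 1) :=
    hfc.comp (f := fun s : ℝ => (s, (0:ℝ), (0:ℝ))) (by fun_prop) fun s hs => ⟨hs, mem_univ _⟩
  have hfbound : ∀ s ∈ Icc (0:ℝ) 1, |f s (x s) (y s)| ≤ L₁ * r + M₁ := fun s hs => by
    have hxs : |x s| ≤ supNorm x := abs_le_iSup_abs_Icc hx hs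
    have hys : |y s| ≤ supNorm y := abs_le_iSup_abs_Icc hy hs
    have hfs : |f s 0 0| ≤ M₁ := hM₁ ▸ abs_le_iSup_abs_Icc hf0 hs
    have hlip := hflip s hs (x s) (y s) 0 0
    rw [sub_zero, sub_zero] at hlip
    have hmul : L₁ * (|x s| + |y s|) ≤ L₁ * r :=
      mul_le_mul_of_nonneg_left (by linarith) hL₁.le
    linarith [abs_sub_abs_le_abs_sub (f s (x s) (y s)) (f s 0 0)]
  have hK : 0 ≤ L₁ * r + M₁ := (abs_nonneg _).trans (hfbound 0 h0)
  have hψrange : ∀ u ∈ Icc (0:ℝ) 1, 0 ≤ ψ u - ψ 0 ∧ ψ u - ψ 0 ≤ ψ 1 - ψ 0 := fun u hu =>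
    ⟨sub_nonneg.2 (hψmono.monotoneOn h0 hu hu.1),
      sub_le_sub_right (hψmono.monotoneOn hu h1 hu.2) _⟩
  have hψP := (hψrange 1 h1).1
  have hint : ∀ u ∈ Icc (0:ℝ) 1,
      |∫ s in (0:ℝ)..u, deriv ψ s * (ψ u - ψ s) ^ (α - 1) * f s (x s) (y s)| ≤
        (L₁ * r + M₁) * ((ψ 1 - ψ 0) ^ α / α) := fun u hu => by
    have hsub : Icc 0 u ⊆ Icc (0:ℝ) 1 := Icc_subset_Icc_right hu.2
    refine (abs_integral_deriv_mul_rpow_mul_le hu.1 (hψmono.monotoneOn.mono hsub)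
      (hψC1.continuousOn.mono hsub)
      (fun s hs => differentiableAt_of_deriv_ne_zero (hψ' s (hsub (Ioo_subset_Icc_self hs))))
      hα1 fun s hs => hfbound s (hsub hs)).trans ?_
    obtain ⟨hu0, huP⟩ := hψrange u hu
    gcongr
  have hΓ : 0 < Real.Gamma α := Real.Gamma_pos_of_pos (by linarith)
  have hIt := hint t ht
  have hI1 := hint 1 h1
  have hIη := hint η ⟨hη0.le, hη1.le⟩
  obtain ⟨ht0, htP⟩ := hψrange t ht
  unfold Tmap
  set It := ∫ s in (0:ℝ)..t, deriv ψ s * (ψ t - ψ s) ^ (α - 1) * f s (x s) (y s)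
  set I1 := ∫ s in (0:ℝ)..1, deriv ψ s * (ψ 1 - ψ s) ^ (α - 1) * f s (x s) (y s)
  set Iη := ∫ s in (0:ℝ)..η, deriv ψ s * (ψ η - ψ s) ^ (α - 1) * f s (x s) (y s)
  set B := (L₁ * r + M₁) * ((ψ 1 - ψ 0) ^ α / α) with hB
  have hB0 : 0 ≤ B := (abs_nonneg _).trans hIt
  calc |1 / Real.Gamma α * It
          + 1 / Δ₁ * (1 / Real.Gamma α * I1 - lam / Real.Gamma α * Iη) * (ψ t - ψ 0)|
      ≤ |1 / Real.Gamma α * It|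
          + |1 / Δ₁ * (1 / Real.Gamma α * I1 - lam / Real.Gamma α * Iη) * (ψ t - ψ 0)| :=
        abs_add_le _ _
    _ ≤ 1 / Real.Gamma α * |It|
          + 1 / |Δ₁| * (1 / Real.Gamma α * |I1| + lam / Real.Gamma α * |Iη|)
            * (ψ t - ψ 0) := by
        have hbr := abs_sub (1 / Real.Gamma α * I1) (lam / Real.Gamma α * Iη)
        rw [abs_mul _ I1, abs_mul _ Iη, abs_of_pos (div_pos one_pos hΓ),
          abs_of_pos (div_pos hlam hΓ)] at hbr
        rw [abs_mul _ It, abs_of_pos (div_pos one_pos hΓ), abs_mul _ (ψ t - ψ 0),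
          abs_of_nonneg ht0, abs_mul (1 / Δ₁), abs_div, abs_one]
        gcongr
    _ ≤ 1 / Real.Gamma α * B
          + 1 / |Δ₁| * (1 / Real.Gamma α * B + lam / Real.Gamma α * B) * (ψ 1 - ψ 0) := by
        gcongr
    _ = _ := by
        rw [Real.Gamma_add_one (by linarith), Real.rpow_add_one' hψP (by linarith), hB]
        have hα0 : α ≠ 0 := by linarith
        have hΔ : |Δ₁| ≠ 0 := abs_ne_zero.2 hΔ₁0
        field_simp
        ring
end

section
/- Assume (A1): f:[0,1]×ℝ²→ℝ is continuous and there exists L₁>0 with |f(t,x₁,y₁)−f(t,x₂,y₂)| ≤ L₁(|x₁−x₂|+|y₁−y₂|) for all t∈[0,1] and x₁,x₂,y₁,y₂∈ℝ. Set γ₃ = (L₁/Γ(α+1))[ (ψ(1)−ψ(0))^α + ((λ+1)/|Δ₁|)(ψ(1)−ψ(0))^{α+1} ]. Then for all continuous x₁,y₁,x₂,y₂:[0,1]→ℝ, ‖T₁(x₁,y₁) − T₁(x₂,y₂)‖ ≤ γ₃ ( ‖x₁−x₂‖ + ‖y₁−y₂‖ ). -/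
open MeasureTheory intervalIntegral Set

lemma abs_le_supNorm {x : ℝ → ℝ} (hx : ContinuousOn x (Icc 0 1)) {t : ℝ} (ht : t ∈ Icc (0:ℝ) 1) :
    |x t| ≤ supNorm x := by
  have hbdd : BddAbove (range fun t : Icc (0:ℝ) 1 => |x t|) := by
    have := (isCompact_Icc.image_of_continuousOn hx.abs).bddAbove
    rwa [image_eq_range] at this
  exact le_ciSup hbdd ⟨t, ht⟩

lemma supNorm_le {x : ℝ → ℝ} {C : ℝ} (h : ∀ t ∈ Icc (0:ℝ) 1, |x t| ≤ C) : supNorm x ≤ C := by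
  have : Nonempty (Icc (0:ℝ) 1) := ⟨⟨0, by simp⟩⟩
  exact ciSup_le fun t => h t t.2

lemma supNorm_nonneg (x : ℝ → ℝ) : 0 ≤ supNorm x :=
  Real.iSup_nonneg fun _ => abs_nonneg _

lemma continuousOn_deriv_of_ne_zero {ψ : ℝ → ℝ} (hC1 : ContDiffOn ℝ 1 ψ (Icc 0 1))
    (hψ' : ∀ t ∈ Icc (0:ℝ) 1, deriv ψ t ≠ 0) : ContinuousOn (deriv ψ) (Icc 0 1) := by
  have hu : UniqueDiffOn ℝ (Icc (0:ℝ) 1) := uniqueDiffOn_Icc zero_lt_one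
  refine (hC1.continuousOn_derivWithin hu le_rfl).congr fun t ht => ?_
  exact ((differentiableAt_of_deriv_ne_zero (hψ' t ht)).derivWithin (hu t ht)).symm

lemma deriv_nonneg_of_monotoneOn {ψ : ℝ → ℝ} (hmono : MonotoneOn ψ (Icc 0 1))
    (hψ' : ∀ t ∈ Icc (0:ℝ) 1, deriv ψ t ≠ 0) {t : ℝ} (ht : t ∈ Icc (0:ℝ) 1) :
    0 ≤ deriv ψ t := by
  rw [← (differentiableAt_of_deriv_ne_zero (hψ' t ht)).derivWithin
    (uniqueDiffOn_Icc zero_lt_one t ht)]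
  exact hmono.derivWithin_nonneg

lemma continuousOn_kernel {ψ : ℝ → ℝ} {α u : ℝ} (hα : 1 < α)
    (hC1 : ContDiffOn ℝ 1 ψ (Icc 0 1)) (hψ' : ∀ t ∈ Icc (0:ℝ) 1, deriv ψ t ≠ 0) :
    ContinuousOn (fun s => deriv ψ s * (ψ u - ψ s) ^ (α - 1)) (Icc 0 1) :=
  (continuousOn_deriv_of_ne_zero hC1 hψ').mul
    ((continuousOn_const.sub hC1.continuousOn).rpow_const fun _ _ => Or.inr (by linarith))

lemma integral_kernel {ψ : ℝ → ℝ} {α u : ℝ} (hα : 1 < α)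
    (hC1 : ContDiffOn ℝ 1 ψ (Icc 0 1)) (hψ' : ∀ t ∈ Icc (0:ℝ) 1, deriv ψ t ≠ 0)
    (hu : u ∈ Icc (0:ℝ) 1) :
    ∫ s in (0:ℝ)..u, deriv ψ s * (ψ u - ψ s) ^ (α - 1) = (ψ u - ψ 0) ^ α / α := by
  have hsub : uIcc 0 u ⊆ Icc (0:ℝ) 1 := by
    rw [uIcc_of_le hu.1]
    exact Icc_subset_Icc_right hu.2
  have hderiv : ∀ s ∈ uIcc 0 u, HasDerivAt (fun s => -((ψ u - ψ s) ^ α / α))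
      (deriv ψ s * (ψ u - ψ s) ^ (α - 1)) s := by
    intro s hs
    have hd := (differentiableAt_of_deriv_ne_zero (hψ' s (hsub hs))).hasDerivAt
    refine (((hd.const_sub (ψ u)).rpow_const (p := α) (Or.inr hα.le)).div_const α).neg.congr_deriv ?_
    have : α ≠ 0 := by linarith
    field_simp
  rw [integral_eq_sub_of_hasDerivAt hderiv
    (((continuousOn_kernel hα hC1 hψ').mono hsub).intervalIntegrable)]
  simp [Real.zero_rpow (by linarith : α ≠ 0)]

lemma abs_integral_kernel_sub_le {ψ : ℝ → ℝ} {α u M : ℝ} {g h : ℝ → ℝ} (hα : 1 < α)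
    (hmono : MonotoneOn ψ (Icc 0 1))
    (hC1 : ContDiffOn ℝ 1 ψ (Icc 0 1)) (hψ' : ∀ t ∈ Icc (0:ℝ) 1, deriv ψ t ≠ 0)
    (hu : u ∈ Icc (0:ℝ) 1) (hM : 0 ≤ M)
    (hg : ContinuousOn g (Icc 0 1)) (hh : ContinuousOn h (Icc 0 1))
    (hgh : ∀ s ∈ Icc (0:ℝ) 1, |g s - h s| ≤ M) :
    |(∫ s in (0:ℝ)..u, deriv ψ s * (ψ u - ψ s) ^ (α - 1) * g s)
      - ∫ s in (0:ℝ)..u, deriv ψ s * (ψ u - ψ s) ^ (α - 1) * h s|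
      ≤ M * ((ψ 1 - ψ 0) ^ α / α) := by
  have hsub : uIcc 0 u ⊆ Icc (0:ℝ) 1 := by
    rw [uIcc_of_le hu.1]
    exact Icc_subset_Icc_right hu.2
  have hk := continuousOn_kernel (u := u) hα hC1 hψ'
  have h0 : (0:ℝ) ∈ Icc (0:ℝ) 1 := by simp
  have h1 : (1:ℝ) ∈ Icc (0:ℝ) 1 := by simp
  have hint : ∀ {φ : ℝ → ℝ}, ContinuousOn φ (Icc 0 1) → IntervalIntegrable
      (fun s => deriv ψ s * (ψ u - ψ s) ^ (α - 1) * φ s) volume 0 u := fun hφ =>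
    ((hk.mul hφ).mono hsub).intervalIntegrable
  rw [← integral_sub (hint hg) (hint hh)]
  calc _ ≤ ∫ s in (0:ℝ)..u, M * (deriv ψ s * (ψ u - ψ s) ^ (α - 1)) := by
        rw [← Real.norm_eq_abs]
        refine norm_integral_le_of_norm_le hu.1 (.of_forall fun s hs => ?_)
          ((hk.mono hsub).intervalIntegrable.const_mul M)
        have hs' : s ∈ Icc (0:ℝ) 1 := ⟨hs.1.le, hs.2.trans hu.2⟩
        have hk0 : 0 ≤ deriv ψ s * (ψ u - ψ s) ^ (α - 1) :=
          mul_nonneg (deriv_nonneg_of_monotoneOn hmono hψ' hs')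
            (Real.rpow_nonneg (sub_nonneg.2 (hmono hs' hu hs.2)) _)
        rw [← mul_sub, Real.norm_eq_abs, abs_mul, abs_of_nonneg hk0, mul_comm M]
        exact mul_le_mul_of_nonneg_left (hgh s hs') hk0
    _ = M * ((ψ u - ψ 0) ^ α / α) := by
        rw [intervalIntegral.integral_const_mul, integral_kernel hα hC1 hψ' hu]
    _ ≤ _ := by
        have := hmono h0 hu hu.1
        have := hmono hu h1 hu.2
        gcongr

/-- **Lipschitz estimate for `T₁`.**
Under (A1), `‖T₁(x₁,y₁) − T₁(x₂,y₂)‖ ≤ γ₃(‖x₁−x₂‖ + ‖y₁−y₂‖)` where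
`γ₃ = (L₁/Γ(α+1))[(ψ(1)−ψ(0))^α + ((λ+1)/|Δ₁|)(ψ(1)−ψ(0))^{α+1}]`. -/
theorem T1_lipschitz
    (α η lam Δ₁ : ℝ) (ψ : ℝ → ℝ) (f : ℝ → ℝ → ℝ → ℝ)
    (hψmono : StrictMonoOn ψ (Icc 0 1))
    (hψC1 : ContDiffOn ℝ 1 ψ (Icc 0 1))
    (hψ' : ∀ t ∈ Icc (0:ℝ) 1, deriv ψ t ≠ 0)
    (hα1 : 1 < α) (hα2 : α < 2)
    (hη0 : 0 < η) (hη1 : η < 1) (hlam : 0 < lam)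
    (hΔ₁ : Δ₁ = lam * (ψ η - ψ 0) - (ψ 1 - ψ 0)) (hΔ₁0 : Δ₁ ≠ 0)
    (hfc : ContinuousOn (fun p : ℝ × ℝ × ℝ => f p.1 p.2.1 p.2.2)
      (Icc 0 1 ×ˢ (univ : Set (ℝ × ℝ))))
    (L₁ : ℝ) (hL₁ : 0 < L₁)
    (hflip : ∀ t ∈ Icc (0:ℝ) 1, ∀ x₁ y₁ x₂ y₂ : ℝ,
      |f t x₁ y₁ - f t x₂ y₂| ≤ L₁ * (|x₁ - x₂| + |y₁ - y₂|))
    (γ₃ : ℝ)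
    (hγ₃ : γ₃ = (L₁ / Real.Gamma (α + 1)) *
      ((ψ 1 - ψ 0) ^ α + ((lam + 1) / |Δ₁|) * (ψ 1 - ψ 0) ^ (α + 1))) :
    ∀ x₁ y₁ x₂ y₂ : ℝ → ℝ,
      ContinuousOn x₁ (Icc 0 1) → ContinuousOn y₁ (Icc 0 1) →
      ContinuousOn x₂ (Icc 0 1) → ContinuousOn y₂ (Icc 0 1) →
      supNorm (fun t => Tmap ψ α η lam Δ₁ f x₁ y₁ t - Tmap ψ α η lam Δ₁ f x₂ y₂ t) ≤
        γ₃ * (supNorm (fun t => x₁ t - x₂ t) + supNorm (fun t => y₁ t - y₂ t)) := by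
  intro x₁ y₁ x₂ y₂ hx₁ hy₁ hx₂ hy₂
  set N := supNorm (fun t => x₁ t - x₂ t) + supNorm (fun t => y₁ t - y₂ t) with hN
  have hN0 : 0 ≤ N := add_nonneg (supNorm_nonneg _) (supNorm_nonneg _)
  have hcomp : ∀ {x y : ℝ → ℝ}, ContinuousOn x (Icc 0 1) → ContinuousOn y (Icc 0 1) →
      ContinuousOn (fun s => f s (x s) (y s)) (Icc 0 1) := fun hx hy =>
    hfc.comp (continuousOn_id.prodMk (hx.prodMk hy)) fun s hs => ⟨hs, mem_univ _⟩
  have hdiff : ∀ s ∈ Icc (0:ℝ) 1, |f s (x₁ s) (y₁ s) - f s (x₂ s) (y₂ s)| ≤ L₁ * N :=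
    fun s hs => (hflip s hs _ _ _ _).trans <| mul_le_mul_of_nonneg_left
      (add_le_add (abs_le_supNorm (hx₁.sub hx₂) hs) (abs_le_supNorm (hy₁.sub hy₂) hs)) hL₁.le
  have hbound : ∀ u ∈ Icc (0:ℝ) 1, _ := fun u hu =>
    abs_integral_kernel_sub_le hα1 hψmono.monotoneOn hψC1 hψ' hu (mul_nonneg hL₁.le hN0)
      (hcomp hx₁ hy₁) (hcomp hx₂ hy₂) hdiff
  have h0 : (0:ℝ) ∈ Icc (0:ℝ) 1 := by simp
  have h1 : (1:ℝ) ∈ Icc (0:ℝ) 1 := by simp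
  have hP : 0 < ψ 1 - ψ 0 := sub_pos.2 (hψmono h0 h1 one_pos)
  have hΓ : 0 < Real.Gamma α := Real.Gamma_pos_of_pos (by linarith)
  refine supNorm_le fun t ht => ?_
  have ht0 : 0 ≤ ψ t - ψ 0 := sub_nonneg.2 (hψmono.monotoneOn h0 ht ht.1)
  have ht1 : ψ t - ψ 0 ≤ ψ 1 - ψ 0 := by linarith [hψmono.monotoneOn ht h1 ht.2]
  have Bt := hbound t ht
  have B1 := hbound 1 h1
  have Bη := hbound η ⟨hη0.le, hη1.le⟩
  rw [hγ₃, Real.Gamma_add_one (by linarith), Real.rpow_add_one hP.ne']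
  unfold Tmap
  generalize (∫ s in (0:ℝ)..t, deriv ψ s * (ψ t - ψ s) ^ (α - 1) * f s (x₁ s) (y₁ s)) = a₁ at *
  generalize (∫ s in (0:ℝ)..t, deriv ψ s * (ψ t - ψ s) ^ (α - 1) * f s (x₂ s) (y₂ s)) = a₂ at *
  generalize (∫ s in (0:ℝ)..1, deriv ψ s * (ψ 1 - ψ s) ^ (α - 1) * f s (x₁ s) (y₁ s)) = b₁ at *
  generalize (∫ s in (0:ℝ)..1, deriv ψ s * (ψ 1 - ψ s) ^ (α - 1) * f s (x₂ s) (y₂ s)) = b₂ at *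
  generalize (∫ s in (0:ℝ)..η, deriv ψ s * (ψ η - ψ s) ^ (α - 1) * f s (x₁ s) (y₁ s)) = c₁ at *
  generalize (∫ s in (0:ℝ)..η, deriv ψ s * (ψ η - ψ s) ^ (α - 1) * f s (x₂ s) (y₂ s)) = c₂ at *
  set K := L₁ * N * ((ψ 1 - ψ 0) ^ α / α) with hK
  have hbc : |(b₁ - b₂) - lam * (c₁ - c₂)| ≤ (lam + 1) * K := by
    calc _ ≤ |b₁ - b₂| + |lam * (c₁ - c₂)| := abs_sub _ _
      _ = |b₁ - b₂| + lam * |c₁ - c₂| := by rw [abs_mul, abs_of_pos hlam]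
      _ ≤ K + lam * K := by gcongr
      _ = _ := by ring
  have hK0 : 0 ≤ K := (abs_nonneg _).trans Bt
  calc _ = |(1 / Real.Gamma α) *
        ((a₁ - a₂) + (1 / Δ₁) * ((b₁ - b₂) - lam * (c₁ - c₂)) * (ψ t - ψ 0))| := by
        congr 1
        ring
    _ = (1 / Real.Gamma α) *
        |(a₁ - a₂) + (1 / Δ₁) * ((b₁ - b₂) - lam * (c₁ - c₂)) * (ψ t - ψ 0)| := by
        rw [abs_mul, abs_of_pos (one_div_pos.2 hΓ)]
    _ ≤ (1 / Real.Gamma α) *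
        (|a₁ - a₂| + 1 / |Δ₁| * |(b₁ - b₂) - lam * (c₁ - c₂)| * (ψ t - ψ 0)) := by
        gcongr
        refine (abs_add_le _ _).trans_eq ?_
        rw [abs_mul, abs_mul, abs_of_nonneg ht0, abs_div, abs_one]
    _ ≤ (1 / Real.Gamma α) * (K + 1 / |Δ₁| * ((lam + 1) * K) * (ψ 1 - ψ 0)) := by
        gcongr
    _ = _ := by
        have := abs_pos.2 hΔ₁0
        rw [hK]
        field_simp
end

section
/- Let f:[0,1]×ℝ²→ℝ be continuous and let x,y:[0,1]→ℝ be continuous functions such that |f(t,x(t),y(t))| ≤ N₁ for all t∈[0,1], where N₁>0. Then ‖T₁(x,y)‖ ≤ (N₁/Γ(α+1))[ (ψ(1)−ψ(0))^α + ((λ+1)/|Δ₁|)(ψ(1)−ψ(0))^{α+1} ]. -/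
open MeasureTheory intervalIntegral Set

/-- A function that is monotone on `[0,1]` has nonnegative derivative wherever that derivative
exists, endpoints included. -/
lemma deriv_nonneg_of_monotoneOn_Icc {ψ : ℝ → ℝ} (hψ : MonotoneOn ψ (Icc 0 1)) {s : ℝ}
    (hs : s ∈ Icc (0 : ℝ) 1) (hd : DifferentiableAt ℝ ψ s) : 0 ≤ deriv ψ s := by
  rw [← hd.derivWithin (uniqueDiffOn_Icc zero_lt_one s hs)]
  exact hψ.derivWithin_nonneg

/-- Bound on the `ψ`-Riemann–Liouville integral of a bounded function. -/
lemma abs_integral_deriv_mul_rpow_mul_le_s11 {ψ h : ℝ → ℝ} {α N t : ℝ}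
    (hψ : MonotoneOn ψ (Icc 0 1)) (hd : ∀ s ∈ Icc (0 : ℝ) 1, DifferentiableAt ℝ ψ s)
    (hα : 1 < α) (hN : 0 ≤ N) (hh : ∀ s ∈ Icc (0 : ℝ) 1, |h s| ≤ N) (ht : t ∈ Icc (0 : ℝ) 1) :
    |∫ s in (0 : ℝ)..t, deriv ψ s * (ψ t - ψ s) ^ (α - 1) * h s| ≤
      N * ((ψ t - ψ 0) ^ α / α) := by
  have hα0 : α ≠ 0 := by linarith
  have hsub : ∀ s ∈ Icc (0 : ℝ) t, s ∈ Icc (0 : ℝ) 1 := fun s hs => ⟨hs.1, hs.2.trans ht.2⟩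
  have hderiv : ∀ s ∈ Icc (0 : ℝ) t, HasDerivAt (fun s => -N * ((ψ t - ψ s) ^ α / α))
      (N * (deriv ψ s * (ψ t - ψ s) ^ (α - 1))) s := by
    intro s hs
    have := ((((hd s (hsub s hs)).hasDerivAt.const_sub (ψ t)).rpow_const
      (p := α) (Or.inr hα.le)).div_const α).const_mul (-N)
    exact this.congr_deriv (by field_simp)
  have hnonneg : ∀ s ∈ Icc (0 : ℝ) t, 0 ≤ deriv ψ s * (ψ t - ψ s) ^ (α - 1) := fun s hs =>
    mul_nonneg (deriv_nonneg_of_monotoneOn_Icc hψ (hsub s hs) (hd s (hsub s hs)))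
      (Real.rpow_nonneg (sub_nonneg.2 (hψ (hsub s hs) ht hs.2)) _)
  have hcont : ContinuousOn (fun s => -N * ((ψ t - ψ s) ^ α / α)) (Icc 0 t) :=
    fun s hs => (hderiv s hs).continuousAt.continuousWithinAt
  have hint : IntervalIntegrable (fun s => N * (deriv ψ s * (ψ t - ψ s) ^ (α - 1)))
      volume 0 t := by
    refine intervalIntegrable_deriv_of_nonneg (by rwa [uIcc_of_le ht.1]) (fun s hs => ?_)
      (fun s hs => ?_)
    all_goals rw [min_eq_left ht.1, max_eq_right ht.1] at hs
    · exact hderiv s (Ioo_subset_Icc_self hs)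
    · exact mul_nonneg hN (hnonneg s (Ioo_subset_Icc_self hs))
  have hle := norm_integral_le_of_norm_le (μ := volume) ht.1
    (f := fun s => deriv ψ s * (ψ t - ψ s) ^ (α - 1) * h s)
    (Filter.Eventually.of_forall fun s hs => by
      have hs' := Ioc_subset_Icc_self hs
      rw [norm_mul, Real.norm_of_nonneg (hnonneg s hs'), mul_comm]
      exact mul_le_mul_of_nonneg_right (hh s (hsub s hs')) (hnonneg s hs')) hint
  rw [integral_eq_sub_of_hasDerivAt_of_le ht.1 hcont
    (fun s hs => hderiv s (Ioo_subset_Icc_self hs)) hint] at hle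
  simpa [Real.zero_rpow hα0] using hle

/-- **Uniform boundedness of `T₁` on bounded sets.**
If `|f(t,x(t),y(t))| ≤ N₁` on `[0,1]`, then
`‖T₁(x,y)‖ ≤ (N₁/Γ(α+1))[(ψ(1)−ψ(0))^α + ((λ+1)/|Δ₁|)(ψ(1)−ψ(0))^{α+1}]`. -/
theorem T1_uniform_bound
    (α η lam Δ₁ : ℝ) (ψ : ℝ → ℝ) (f : ℝ → ℝ → ℝ → ℝ)
    (hψmono : StrictMonoOn ψ (Icc 0 1))
    (hψC1 : ContDiffOn ℝ 1 ψ (Icc 0 1))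
    (hψ' : ∀ t ∈ Icc (0:ℝ) 1, deriv ψ t ≠ 0)
    (hα1 : 1 < α) (hα2 : α < 2)
    (hη0 : 0 < η) (hη1 : η < 1) (hlam : 0 < lam)
    (hΔ₁ : Δ₁ = lam * (ψ η - ψ 0) - (ψ 1 - ψ 0)) (hΔ₁0 : Δ₁ ≠ 0)
    (hfc : ContinuousOn (fun p : ℝ × ℝ × ℝ => f p.1 p.2.1 p.2.2)
      (Icc 0 1 ×ˢ (univ : Set (ℝ × ℝ))))
    (x y : ℝ → ℝ) (hx : ContinuousOn x (Icc 0 1)) (hy : ContinuousOn y (Icc 0 1))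
    (N₁ : ℝ) (hN₁ : 0 < N₁)
    (hbound : ∀ t ∈ Icc (0:ℝ) 1, |f t (x t) (y t)| ≤ N₁) :
    supNorm (Tmap ψ α η lam Δ₁ f x y) ≤
      (N₁ / Real.Gamma (α + 1)) *
        ((ψ 1 - ψ 0) ^ α + ((lam + 1) / |Δ₁|) * (ψ 1 - ψ 0) ^ (α + 1)) := by
  have hd : ∀ s ∈ Icc (0 : ℝ) 1, DifferentiableAt ℝ ψ s :=
    fun s hs => differentiableAt_of_deriv_ne_zero (hψ' s hs)
  have hα0 : 0 < α := by linarith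
  have hΓ : 0 < Real.Gamma α := Real.Gamma_pos_of_pos hα0
  have h0 : (0 : ℝ) ∈ Icc (0 : ℝ) 1 := by simp
  have h1 : (1 : ℝ) ∈ Icc (0 : ℝ) 1 := by simp
  have hη : η ∈ Icc (0 : ℝ) 1 := ⟨hη0.le, hη1.le⟩
  have hP : 0 < ψ 1 - ψ 0 := sub_pos.2 (hψmono h0 h1 zero_lt_one)
  have hI : ∀ t ∈ Icc (0 : ℝ) 1,
      |∫ s in (0 : ℝ)..t, deriv ψ s * (ψ t - ψ s) ^ (α - 1) * f s (x s) (y s)| ≤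
        N₁ * ((ψ 1 - ψ 0) ^ α / α) := by
    intro t ht
    refine (abs_integral_deriv_mul_rpow_mul_le_s11 hψmono.monotoneOn hd hα1 hN₁.le hbound ht).trans ?_
    have h0t := hψmono.monotoneOn h0 ht ht.1
    have ht1 := hψmono.monotoneOn ht h1 ht.2
    have := Real.rpow_le_rpow (sub_nonneg.2 h0t) (sub_le_sub_right ht1 (ψ 0)) hα0.le
    gcongr
  refine ciSup_le fun ⟨t, ht⟩ => ?_
  have ht0 : 0 ≤ ψ t - ψ 0 := sub_nonneg.2 (hψmono.monotoneOn h0 ht ht.1)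
  have ht1 : ψ t - ψ 0 ≤ ψ 1 - ψ 0 := sub_le_sub_right (hψmono.monotoneOn ht h1 ht.2) _
  have hIt := hI t ht
  have hI1 := hI 1 h1
  have hIη := hI η hη
  set B := N₁ * ((ψ 1 - ψ 0) ^ α / α) with hB
  have hB0 : 0 ≤ B := (abs_nonneg _).trans hI1
  have key : ∀ I J K : ℝ, |I| ≤ B → |J| ≤ B → |K| ≤ B →
      |1 / Real.Gamma α * I + 1 / Δ₁ * (1 / Real.Gamma α * J - lam / Real.Gamma α * K) *
        (ψ t - ψ 0)| ≤ 1 / Real.Gamma α * B + 1 / |Δ₁| *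
          (1 / Real.Gamma α * B + lam / Real.Gamma α * B) * (ψ 1 - ψ 0) := by
    intro I J K hI hJ hK
    refine (abs_add_le _ _).trans (add_le_add ?_ ?_)
    · rw [abs_mul, abs_of_pos (one_div_pos.2 hΓ)]
      gcongr
    · rw [abs_mul, abs_mul, abs_of_nonneg ht0, abs_div, abs_one]
      gcongr
      refine (abs_sub _ _).trans (add_le_add ?_ ?_)
      · rw [abs_mul, abs_of_pos (one_div_pos.2 hΓ)]
        gcongr
      · rw [abs_mul, abs_of_pos (div_pos hlam hΓ)]
        gcongr
  refine (key _ _ _ hIt hI1 hIη).trans (le_of_eq ?_)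
  rw [Real.Gamma_add_one hα0.ne', Real.rpow_add_one hP.ne', hB]
  have := abs_pos.2 hΔ₁0
  field_simp
  ring
end

section
/- Let f:[0,1]×ℝ²→ℝ be continuous and let x,y:[0,1]→ℝ be continuous functions such that |f(t,x(t),y(t))| ≤ N₁ for all t∈[0,1], where N₁>0. Then for all t₁,t₂∈[0,1] with t₁<t₂, |T₁(x,y)(t₂) − T₁(x,y)(t₁)| ≤ (N₁/Γ(α+1))[ (ψ(t₂)−ψ(0))^α − (ψ(t₁)−ψ(0))^α ] + (N₁/(|Δ₁|Γ(α+1)))[ (ψ(1)−ψ(0))^α + λ(ψ(η)−ψ(0))^α ](ψ(t₂)−ψ(t₁)). In particular, the family {T₁(x,y) : |f(·,x(·),y(·))| ≤ N₁} is equicontinuous on [0,1]. -/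
open MeasureTheory intervalIntegral Set

/-- A weighted kernel `ψ'(s) (ψ t - ψ s) ^ p` is continuous in `s` up to the endpoint `t`. -/
theorem continuousOn_deriv_mul_rpow_sub {ψ : ℝ → ℝ} {p a b c : ℝ} (hp : 0 ≤ p)
    (hψ : ContinuousOn ψ (Icc a b)) (hdψ : ContinuousOn (deriv ψ) (Icc a b)) :
    ContinuousOn (fun s => deriv ψ s * (c - ψ s) ^ p) (Icc a b) :=
  hdψ.mul ((continuousOn_const.sub hψ).rpow_const fun _ _ => Or.inr hp)

/-- The Riemann–Liouville kernel with respect to `ψ` has an explicit primitive. -/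
theorem integral_deriv_mul_rpow_sub {ψ : ℝ → ℝ} {α a t : ℝ} (hα : 1 < α) (hat : a ≤ t)
    (hdiff : ∀ s ∈ Icc a t, DifferentiableAt ℝ ψ s)
    (hdψ : ContinuousOn (deriv ψ) (Icc a t)) :
    ∫ s in a..t, deriv ψ s * (ψ t - ψ s) ^ (α - 1) = (ψ t - ψ a) ^ α / α := by
  have hα0 : α ≠ 0 := by positivity
  have hψ : ContinuousOn ψ (Icc a t) := fun s hs => (hdiff s hs).continuousAt.continuousWithinAt
  have hcont : ContinuousOn (fun s => deriv ψ s * (ψ t - ψ s) ^ (α - 1)) (Icc a t) :=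
    continuousOn_deriv_mul_rpow_sub (by linarith) hψ hdψ
  rw [integral_eq_sub_of_hasDerivAt (f := fun s => -((ψ t - ψ s) ^ α / α))]
  · simp [Real.zero_rpow hα0]
  · intro s hs
    rw [uIcc_of_le hat] at hs
    have h := ((((hdiff s hs).hasDerivAt.const_sub (ψ t)).rpow_const
      (Or.inr hα.le)).div_const α).neg
    refine h.congr_deriv ?_
    field_simp
  · exact hcont.intervalIntegrable_of_Icc hat

/-- The unnormalised `ψ`-fractional integral of order at least one of a nonnegative function is
monotone in the upper limit. -/
theorem integral_deriv_mul_rpow_sub_mul_mono {ψ G : ℝ → ℝ} {p a t₁ t₂ : ℝ} (hp : 0 ≤ p)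
    (ha : a ≤ t₁) (ht : t₁ ≤ t₂) (hmono : MonotoneOn ψ (Icc a t₂))
    (hψ : ContinuousOn ψ (Icc a t₂)) (hdψ : ContinuousOn (deriv ψ) (Icc a t₂))
    (hpos : ∀ s ∈ Icc a t₂, 0 ≤ deriv ψ s)
    (hG : ContinuousOn G (Icc a t₂)) (hG0 : ∀ s ∈ Icc a t₂, 0 ≤ G s) :
    ∫ s in a..t₁, deriv ψ s * (ψ t₁ - ψ s) ^ p * G s ≤
      ∫ s in a..t₂, deriv ψ s * (ψ t₂ - ψ s) ^ p * G s := by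
  have hc (c : ℝ) : ContinuousOn (fun s => deriv ψ s * (c - ψ s) ^ p * G s) (Icc a t₂) :=
    (continuousOn_deriv_mul_rpow_sub hp hψ hdψ).mul hG
  have hint₁ (c : ℝ) : IntervalIntegrable (fun s => deriv ψ s * (c - ψ s) ^ p * G s) volume a t₁ :=
    ((hc c).mono (Icc_subset_Icc_right ht)).intervalIntegrable_of_Icc ha
  have hint₂ : IntervalIntegrable (fun s => deriv ψ s * (ψ t₂ - ψ s) ^ p * G s) volume t₁ t₂ :=
    ((hc _).mono (Icc_subset_Icc_left ha)).intervalIntegrable_of_Icc ht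
  rw [← integral_add_adjacent_intervals (hint₁ (ψ t₂)) hint₂]
  have h₁ : ∫ s in a..t₁, deriv ψ s * (ψ t₁ - ψ s) ^ p * G s ≤
      ∫ s in a..t₁, deriv ψ s * (ψ t₂ - ψ s) ^ p * G s := by
    refine integral_mono_on ha (hint₁ _) (hint₁ _) fun s hs => ?_
    have hs' : s ∈ Icc a t₂ := ⟨hs.1, hs.2.trans ht⟩
    have ht₁ : t₁ ∈ Icc a t₂ := ⟨ha, ht⟩
    have h₁ := hmono hs' ht₁ hs.2
    have h₂ := hmono ht₁ ⟨ha.trans ht, le_rfl⟩ ht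
    refine mul_le_mul_of_nonneg_right (mul_le_mul_of_nonneg_left ?_ (hpos s hs')) (hG0 s hs')
    exact Real.rpow_le_rpow (by linarith) (by linarith) hp
  have h₂ : 0 ≤ ∫ s in t₁..t₂, deriv ψ s * (ψ t₂ - ψ s) ^ p * G s := by
    refine integral_nonneg ht fun s hs => ?_
    have hs' : s ∈ Icc a t₂ := ⟨ha.trans hs.1, hs.2⟩
    have h := hmono hs' ⟨ha.trans ht, le_rfl⟩ hs.2
    exact mul_nonneg (mul_nonneg (hpos s hs') (Real.rpow_nonneg (by linarith) _)) (hG0 s hs')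
  linarith

/-- Increments of the unnormalised `ψ`-fractional integral of a bounded function. -/
theorem abs_integral_deriv_mul_rpow_sub_mul_sub_le {ψ F : ℝ → ℝ} {α N a t₁ t₂ : ℝ} (hα : 1 < α)
    (ha : a ≤ t₁) (ht : t₁ ≤ t₂) (hmono : MonotoneOn ψ (Icc a t₂))
    (hdiff : ∀ s ∈ Icc a t₂, DifferentiableAt ℝ ψ s)
    (hdψ : ContinuousOn (deriv ψ) (Icc a t₂))
    (hpos : ∀ s ∈ Icc a t₂, 0 ≤ deriv ψ s)
    (hF : ContinuousOn F (Icc a t₂)) (hN : ∀ s ∈ Icc a t₂, |F s| ≤ N) :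
    |(∫ s in a..t₂, deriv ψ s * (ψ t₂ - ψ s) ^ (α - 1) * F s) -
      ∫ s in a..t₁, deriv ψ s * (ψ t₁ - ψ s) ^ (α - 1) * F s| ≤
      N / α * ((ψ t₂ - ψ a) ^ α - (ψ t₁ - ψ a) ^ α) := by
  have hψ : ContinuousOn ψ (Icc a t₂) := fun s hs => (hdiff s hs).continuousAt.continuousWithinAt
  have hp : 0 ≤ α - 1 := by linarith
  have hsplit (σ t : ℝ) (hat : a ≤ t) (htt : t ≤ t₂) :
      ∫ s in a..t, deriv ψ s * (ψ t - ψ s) ^ (α - 1) * (N + σ * F s) =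
        N * ((ψ t - ψ a) ^ α / α) +
          σ * ∫ s in a..t, deriv ψ s * (ψ t - ψ s) ^ (α - 1) * F s := by
    have hsub : Icc a t ⊆ Icc a t₂ := Icc_subset_Icc_right htt
    have hk := (continuousOn_deriv_mul_rpow_sub (c := ψ t) hp hψ hdψ).mono hsub
    rw [← integral_deriv_mul_rpow_sub hα hat (fun s hs => hdiff s (hsub hs)) (hdψ.mono hsub),
      ← intervalIntegral.integral_const_mul, ← intervalIntegral.integral_const_mul,
      ← intervalIntegral.integral_add]
    · congr 1
      ext s
      ring
    · exact (hk.intervalIntegrable_of_Icc hat).const_mul N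
    · exact ((hk.mul (hF.mono hsub)).intervalIntegrable_of_Icc hat).const_mul σ
  have key (σ : ℝ) (hσ : ∀ s ∈ Icc a t₂, 0 ≤ N + σ * F s) :=
    integral_deriv_mul_rpow_sub_mul_mono (G := fun s => N + σ * F s) hp ha ht hmono hψ hdψ hpos
      (continuousOn_const.add (continuousOn_const.mul hF)) hσ
  have h₁ := key 1 fun s hs => by linarith [(abs_le.1 (hN s hs)).1]
  have h₂ := key (-1) fun s hs => by linarith [(abs_le.1 (hN s hs)).2]
  rw [hsplit _ _ ha ht, hsplit _ _ (ha.trans ht) le_rfl] at h₁ h₂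
  have h₃ : N / α * ((ψ t₂ - ψ a) ^ α - (ψ t₁ - ψ a) ^ α) =
      N * ((ψ t₂ - ψ a) ^ α / α) - N * ((ψ t₁ - ψ a) ^ α / α) := by ring
  rw [abs_le, h₃]
  constructor <;> linarith

/-- **Equicontinuity estimate for `T₁`.**
If `|f(t,x(t),y(t))| ≤ N₁` on `[0,1]`, then for `t₁ < t₂` in `[0,1]`,
`|T₁(x,y)(t₂) − T₁(x,y)(t₁)| ≤ (N₁/Γ(α+1))[(ψ(t₂)−ψ(0))^α − (ψ(t₁)−ψ(0))^α]
+ (N₁/(|Δ₁|Γ(α+1)))[(ψ(1)−ψ(0))^α + λ(ψ(η)−ψ(0))^α](ψ(t₂)−ψ(t₁))`. -/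
theorem T1_equicontinuity_estimate
    (α η lam Δ₁ : ℝ) (ψ : ℝ → ℝ) (f : ℝ → ℝ → ℝ → ℝ)
    (hψmono : StrictMonoOn ψ (Icc 0 1))
    (hψC1 : ContDiffOn ℝ 1 ψ (Icc 0 1))
    (hψ' : ∀ t ∈ Icc (0:ℝ) 1, deriv ψ t ≠ 0)
    (hα1 : 1 < α) (hα2 : α < 2)
    (hη0 : 0 < η) (hη1 : η < 1) (hlam : 0 < lam)
    (hΔ₁ : Δ₁ = lam * (ψ η - ψ 0) - (ψ 1 - ψ 0)) (hΔ₁0 : Δ₁ ≠ 0)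
    (hfc : ContinuousOn (fun p : ℝ × ℝ × ℝ => f p.1 p.2.1 p.2.2)
      (Icc 0 1 ×ˢ (univ : Set (ℝ × ℝ))))
    (x y : ℝ → ℝ) (hx : ContinuousOn x (Icc 0 1)) (hy : ContinuousOn y (Icc 0 1))
    (N₁ : ℝ) (hN₁ : 0 < N₁)
    (hbound : ∀ t ∈ Icc (0:ℝ) 1, |f t (x t) (y t)| ≤ N₁) :
    ∀ t₁ ∈ Icc (0:ℝ) 1, ∀ t₂ ∈ Icc (0:ℝ) 1, t₁ < t₂ →
      |Tmap ψ α η lam Δ₁ f x y t₂ - Tmap ψ α η lam Δ₁ f x y t₁| ≤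
        (N₁ / Real.Gamma (α + 1)) * ((ψ t₂ - ψ 0) ^ α - (ψ t₁ - ψ 0) ^ α)
        + (N₁ / (|Δ₁| * Real.Gamma (α + 1))) *
            ((ψ 1 - ψ 0) ^ α + lam * (ψ η - ψ 0) ^ α) * (ψ t₂ - ψ t₁) := by
  have hdiff : ∀ s ∈ Icc (0:ℝ) 1, DifferentiableAt ℝ ψ s := fun s hs =>
    differentiableAt_of_deriv_ne_zero (hψ' s hs)
  have hderiv : EqOn (derivWithin ψ (Icc 0 1)) (deriv ψ) (Icc 0 1) := fun s hs =>
    (hdiff s hs).derivWithin (uniqueDiffOn_Icc one_pos s hs)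
  have hdψ : ContinuousOn (deriv ψ) (Icc 0 1) :=
    (hψC1.continuousOn_derivWithin (uniqueDiffOn_Icc one_pos) le_rfl).congr hderiv.symm
  have hpos : ∀ s ∈ Icc (0:ℝ) 1, 0 ≤ deriv ψ s := fun s hs =>
    hderiv hs ▸ hψmono.monotoneOn.derivWithin_nonneg
  have hF : ContinuousOn (fun s => f s (x s) (y s)) (Icc 0 1) :=
    hfc.comp (continuousOn_id.prodMk (hx.prodMk hy)) fun s hs => ⟨hs, mem_univ _⟩
  have key (t₁ t₂ : ℝ) (h₀ : 0 ≤ t₁) (h : t₁ ≤ t₂) (h₁ : t₂ ≤ 1) :=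
    have hsub : Icc 0 t₂ ⊆ Icc (0:ℝ) 1 := Icc_subset_Icc_right h₁
    abs_integral_deriv_mul_rpow_sub_mul_sub_le hα1 h₀ h (hψmono.monotoneOn.mono hsub)
      (fun s hs => hdiff s (hsub hs)) (hdψ.mono hsub) (fun s hs => hpos s (hsub hs))
      (hF.mono hsub) (fun s hs => hbound s (hsub hs))
  have hα0 : α ≠ 0 := by positivity
  have key₀ (t : ℝ) (h₀ : 0 ≤ t) (h₁ : t ≤ 1) :
      |∫ s in (0:ℝ)..t, deriv ψ s * (ψ t - ψ s) ^ (α - 1) * f s (x s) (y s)| ≤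
        N₁ / α * (ψ t - ψ 0) ^ α := by
    simpa [Real.zero_rpow hα0] using key 0 t le_rfl h₀ h₁
  intro t₁ ht₁ t₂ ht₂ ht
  have hJ := key t₁ t₂ ht₁.1 ht.le ht₂.2
  have hJ₁ := key₀ 1 zero_le_one le_rfl
  have hJη := key₀ η hη0.le hη1.le
  have hψt : 0 < ψ t₂ - ψ t₁ := sub_pos.2 (hψmono ht₁ ht₂ ht)
  have hΓ : 0 < Real.Gamma α := Real.Gamma_pos_of_pos (by linarith)
  unfold Tmap
  rw [Real.Gamma_add_one hα0]
  set J : ℝ → ℝ := fun t =>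
    ∫ s in (0:ℝ)..t, deriv ψ s * (ψ t - ψ s) ^ (α - 1) * f s (x s) (y s) with hJdef
  change |J t₂ - J t₁| ≤ _ at hJ
  change |J 1| ≤ _ at hJ₁
  change |J η| ≤ _ at hJη
  change |1 / Real.Gamma α * J t₂ + 1 / Δ₁ * (1 / Real.Gamma α * J 1 - lam / Real.Gamma α * J η) *
      (ψ t₂ - ψ 0) - (1 / Real.Gamma α * J t₁ +
      1 / Δ₁ * (1 / Real.Gamma α * J 1 - lam / Real.Gamma α * J η) * (ψ t₁ - ψ 0))| ≤ _
  have hdecomp : 1 / Real.Gamma α * J t₂ +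
      1 / Δ₁ * (1 / Real.Gamma α * J 1 - lam / Real.Gamma α * J η) * (ψ t₂ - ψ 0) -
      (1 / Real.Gamma α * J t₁ +
      1 / Δ₁ * (1 / Real.Gamma α * J 1 - lam / Real.Gamma α * J η) * (ψ t₁ - ψ 0)) =
      (J t₂ - J t₁) / Real.Gamma α +
        (J 1 - lam * J η) / (Δ₁ * Real.Gamma α) * (ψ t₂ - ψ t₁) := by
    field_simp
    ring
  have hbd : |J 1 - lam * J η| ≤
      N₁ / α * (ψ 1 - ψ 0) ^ α + lam * (N₁ / α * (ψ η - ψ 0) ^ α) := by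
    refine (abs_sub _ _).trans (add_le_add hJ₁ ?_)
    rw [abs_mul, abs_of_pos hlam]
    exact mul_le_mul_of_nonneg_left hJη hlam.le
  rw [hdecomp]
  calc _ ≤ |J t₂ - J t₁| / Real.Gamma α +
        |J 1 - lam * J η| / (|Δ₁| * Real.Gamma α) * (ψ t₂ - ψ t₁) := by
        refine (abs_add_le _ _).trans_eq ?_
        rw [abs_mul, abs_div, abs_div, abs_mul, abs_of_pos hΓ, abs_of_pos hψt]
    _ ≤ N₁ / α * ((ψ t₂ - ψ 0) ^ α - (ψ t₁ - ψ 0) ^ α) / Real.Gamma α +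
        (N₁ / α * (ψ 1 - ψ 0) ^ α + lam * (N₁ / α * (ψ η - ψ 0) ^ α)) /
          (|Δ₁| * Real.Gamma α) * (ψ t₂ - ψ t₁) := by
        gcongr
    _ = _ := by
        field_simp
end

section
/- (Existence theorem.) Assume (A2): f,g:[0,1]×ℝ²→ℝ are continuous and there exist constants k₀,l₀>0 and k₁,k₂,l₁,l₂≥0 with |f(t,x,y)| ≤ k₀+k₁|x|+k₂|y| and |g(t,x,y)| ≤ l₀+l₁|x|+l₂|y| for all t∈[0,1], x,y∈ℝ. Set A = (1/Γ(α+1))[(ψ(1)−ψ(0))^α + ((λ+1)/|Δ₁|)(ψ(1)−ψ(0))^{α+1}], B = (1/Γ(β+1))[(ψ(1)−ψ(0))^β + ((μ+1)/|Δ₂|)(ψ(1)−ψ(0))^{β+1}], Ω₁ = A k₁ + B l₁, Ω₂ = A k₂ + B l₂, and Ω* = max{Ω₁,Ω₂}. If Ω* < 1, then there exists at least one pair of continuous functions x,y:[0,1]→ℝ satisfying x(t) = T₁(x,y)(t) and y(t) = T₂(x,y)(t) for all t∈[0,1]. -/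
open MeasureTheory intervalIntegral Set

open Metric in
/-- A function which is Lipschitz on the closed unit ball and vanishes outside its interior is
Lipschitz. -/
lemma lipschitzWith_of_closedBall_of_eq_zero {E : Type*} [NormedAddCommGroup E] [NormedSpace ℝ E]
    {h : E → E} {K : NNReal} (hK : LipschitzOnWith K h (closedBall 0 1))
    (hout : ∀ x, 1 ≤ ‖x‖ → h x = 0) : LipschitzWith K h := by
  have key : ∀ x y : E, ‖x‖ ≤ 1 → 1 ≤ ‖y‖ → dist (h x) (h y) ≤ K * dist x y := by
    intro x y hx hy
    have hcont : ContinuousOn (fun t : ℝ => ‖AffineMap.lineMap x y t‖) (Set.Icc 0 1) :=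
      (AffineMap.lineMap_continuous (R := ℝ)).norm.continuousOn
    obtain ⟨t, ht, hzt⟩ := intermediate_value_Icc zero_le_one hcont
      (show (1 : ℝ) ∈ _ by simpa using ⟨hx, hy⟩)
    have hz : h (AffineMap.lineMap x y t) = h y := by
      rw [hout _ hzt.ge, hout y hy]
    rw [← hz]
    refine (hK.dist_le_mul x (by simpa using hx) _ (by simpa using hzt.le)).trans ?_
    gcongr
    rw [dist_left_lineMap, Real.norm_of_nonneg ht.1]
    exact mul_le_of_le_one_left dist_nonneg ht.2
  refine LipschitzWith.of_dist_le_mul fun x y => ?_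
  rcases le_total ‖x‖ 1 with hx | hx <;> rcases le_total ‖y‖ 1 with hy | hy
  · exact hK.dist_le_mul x (by simpa using hx) y (by simpa using hy)
  · exact key x y hx hy
  · rw [dist_comm, dist_comm x]; exact key y x hy hx
  · rw [hout x hx, hout y hy, dist_self]; positivity

open Polynomial in
lemma exists_polynomial_eval_eq_det {E : Type*} [NormedAddCommGroup E] [NormedSpace ℝ E]
    [FiniteDimensional ℝ E] (M : E →L[ℝ] E) :
    ∃ p : ℝ[X], p.natDegree ≤ Module.finrank ℝ E ∧
      ∀ t : ℝ, p.eval t = (ContinuousLinearMap.id ℝ E + t • M).det := by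
  classical
  let b := Module.finBasis ℝ E
  let A := LinearMap.toMatrix b b (M : E →ₗ[ℝ] E)
  have hnat := natDegree_det_X_add_C_le A 1
  rw [Fintype.card_fin] at hnat
  refine ⟨_, hnat, fun t => ?_⟩
  have hA : LinearMap.toMatrix b b
      ((ContinuousLinearMap.id ℝ E + t • M : E →L[ℝ] E) : E →ₗ[ℝ] E) = 1 + t • A := by
    rw [ContinuousLinearMap.toLinearMap_add, ContinuousLinearMap.toLinearMap_smul, map_add, map_smul,
      ContinuousLinearMap.coe_id, LinearMap.toMatrix_id]
  rw [ContinuousLinearMap.det, ← LinearMap.det_toMatrix b, hA, ← coe_evalRingHom,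
    RingHom.map_det]
  congr 1
  ext i j
  simp only [RingHom.mapMatrix_apply, Matrix.map_apply, Matrix.add_apply, Matrix.smul_apply,
    smul_eq_mul, coe_evalRingHom, eval_add, eval_mul, eval_X, eval_C]
  rw [add_comm]

open Metric MeasureTheory in
/-- Small perturbations of the identity vanishing outside the unit ball preserve its volume. -/
lemma integral_det_id_add_smul_eq {E : Type*} [NormedAddCommGroup E] [NormedSpace ℝ E]
    [FiniteDimensional ℝ E] [MeasurableSpace E] [BorelSpace E] (ν : Measure E)
    [ν.IsAddHaarMeasure] {h : E → E} {K : NNReal} (hK : LipschitzWith K h)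
    (hout : ∀ x, 1 ≤ ‖x‖ → h x = 0) (hd : ∀ x ∈ ball (0 : E) 1, DifferentiableAt ℝ h x) :
    ∃ δ > 0, ∀ t ∈ Set.Ioo (0 : ℝ) δ,
      ∫ x in ball (0 : E) 1, (ContinuousLinearMap.id ℝ E + t • fderiv ℝ h x).det ∂ν
        = ν.real (ball (0 : E) 1) := by
  have hdet : ∃ δ₁ > 0, ∀ M : E →L[ℝ] E, ‖M‖ < δ₁ →
      0 < (ContinuousLinearMap.id ℝ E + M).det := by
    have hc : Continuous fun M : E →L[ℝ] E => (ContinuousLinearMap.id ℝ E + M).det :=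
      ContinuousLinearMap.continuous_det.comp (continuous_const.add continuous_id)
    have h0 : (0 : ℝ) < (ContinuousLinearMap.id ℝ E + (0 : E →L[ℝ] E)).det := by
      simp [ContinuousLinearMap.det]
    obtain ⟨δ, hδ, H⟩ := Metric.eventually_nhds_iff.1 (hc.continuousAt.eventually_const_lt h0)
    exact ⟨δ, hδ, fun M hM => H (by simpa using hM)⟩
  obtain ⟨δ₁, hδ₁, hpos⟩ := hdet
  have hK1 : (0 : ℝ) < K + 1 := by positivity
  refine ⟨min 1 δ₁ / (K + 1), by positivity, fun t ht => ?_⟩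
  have htK : t * K < min 1 δ₁ := by
    have := (lt_div_iff₀ hK1).1 ht.2
    nlinarith [ht.1]
  have hlip : ApproximatesLinearOn (fun x => x + t • h x)
      ((ContinuousLinearEquiv.refl ℝ E : E ≃L[ℝ] E) : E →L[ℝ] E) Set.univ
      (t.toNNReal * K) := by
    intro x _ y _
    have : x + t • h x - (y + t • h y) - ((ContinuousLinearEquiv.refl ℝ E : E ≃L[ℝ] E) :
        E →L[ℝ] E) (x - y) = t • (h x - h y) := by
      simp only [ContinuousLinearEquiv.coe_refl, ContinuousLinearMap.id_apply]
      module
    rw [this, norm_smul, Real.norm_of_nonneg ht.1.le, NNReal.coe_mul,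
      Real.coe_toNNReal t ht.1.le, mul_assoc]
    exact mul_le_mul_of_nonneg_left (hK.norm_sub_le x y) ht.1.le
  have hc : Subsingleton E ∨ t.toNNReal * K <
      ‖((ContinuousLinearEquiv.refl ℝ E : E ≃L[ℝ] E).symm : E →L[ℝ] E)‖₊⁻¹ := by
    rcases subsingleton_or_nontrivial E with hE | hE
    · exact Or.inl hE
    · right
      have h1 : ‖((ContinuousLinearEquiv.refl ℝ E : E ≃L[ℝ] E).symm : E →L[ℝ] E)‖₊ = 1 := by
        ext; simp
      rw [h1, inv_one, ← NNReal.coe_lt_coe, NNReal.coe_mul, Real.coe_toNNReal t ht.1.le]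
      exact htK.trans_le (min_le_left _ _)
  have hsurj := hlip.surjective hc
  have hinj : Function.Injective (fun x => x + t • h x) := by
    have := hlip.injective hc
    intro x y hxy
    exact congrArg Subtype.val (@this ⟨x, trivial⟩ ⟨y, trivial⟩ hxy)
  have himage : (fun x => x + t • h x) '' ball 0 1 = ball 0 1 := by
    ext y
    simp only [Set.mem_image, mem_ball_zero_iff]
    constructor
    · rintro ⟨x, hx, rfl⟩
      by_contra! hy
      have := hinj (a₁ := x + t • h x) (a₂ := x) (by simp [hout _ hy])
      rw [this] at hy
      linarith
    · intro hy
      obtain ⟨x, rfl⟩ := hsurj y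
      refine ⟨x, ?_, rfl⟩
      by_contra! hx
      simp only [hout x hx, smul_zero, add_zero] at hy
      linarith
  have hcov := integral_image_eq_integral_abs_det_fderiv_smul ν (s := ball (0 : E) 1)
    (f := fun x => x + t • h x) (f' := fun x => ContinuousLinearMap.id ℝ E + t • fderiv ℝ h x)
    measurableSet_ball
    (fun x hx => ((hasFDerivAt_id x).add
      ((hd x hx).hasFDerivAt.const_smul t)).hasFDerivWithinAt)
    hinj.injOn (fun _ => (1 : ℝ))
  rw [himage] at hcov
  simp only [MeasureTheory.integral_const, smul_eq_mul, mul_one, measureReal_restrict_apply_univ] at hcov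
  rw [hcov]
  refine setIntegral_congr_fun measurableSet_ball fun x hx => ?_
  refine (abs_of_pos (hpos _ ?_)).symm
  rw [norm_smul, Real.norm_of_nonneg ht.1.le]
  calc t * ‖fderiv ℝ h x‖ ≤ t * K :=
        mul_le_mul_of_nonneg_left (norm_fderiv_le_of_lipschitz ℝ hK) ht.1.le
    _ < δ₁ := htK.trans_le (min_le_right _ _)

open Metric MeasureTheory in
/-- A Lipschitz map vanishing outside the unit ball and differentiable in it cannot have a
singular derivative of `id + h` throughout the ball. -/
lemma exists_det_id_add_fderiv_ne_zero {E : Type*} [NormedAddCommGroup E] [NormedSpace ℝ E]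
    [FiniteDimensional ℝ E] {h : E → E} {K : NNReal} (hK : LipschitzWith K h)
    (hout : ∀ x, 1 ≤ ‖x‖ → h x = 0) (hd : ∀ x ∈ ball (0 : E) 1, DifferentiableAt ℝ h x) :
    ∃ x ∈ ball (0 : E) 1, (ContinuousLinearMap.id ℝ E + fderiv ℝ h x).det ≠ 0 := by
  classical
  borelize E
  let ν : Measure E := Measure.addHaar
  by_contra! hzero
  obtain ⟨δ, hδ, hint⟩ := integral_det_id_add_smul_eq ν hK hout hd
  set n := Module.finrank ℝ E
  let v : ℕ → ℝ := fun i => δ / (i + 2)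
  have hv : ∀ i, v i ∈ Set.Ioo 0 δ := fun i =>
    ⟨by positivity, div_lt_self hδ (by linarith [(Nat.cast_nonneg i : (0 : ℝ) ≤ i)])⟩
  have hvinj : Set.InjOn v (Finset.range (n + 1)) := by
    intro i _ j _ hij
    have hi : ((i : ℝ) + 2) ≠ 0 := by positivity
    have hj : ((j : ℝ) + 2) ≠ 0 := by positivity
    simp only [v] at hij
    rw [div_eq_div_iff hi hj] at hij
    have := mul_left_cancel₀ hδ.ne' hij
    exact_mod_cast (by linarith : (i : ℝ) = j)
  let c : ℕ → ℝ := fun i => (Lagrange.basis (Finset.range (n + 1)) v i).eval 1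
  have hc : ∑ i ∈ Finset.range (n + 1), c i = 1 := by
    rw [← Polynomial.eval_finsetSum, Lagrange.sum_basis hvinj (by simp), Polynomial.eval_one]
  have hinterp : ∀ M : E →L[ℝ] E, (ContinuousLinearMap.id ℝ E + M).det =
      ∑ i ∈ Finset.range (n + 1), c i * (ContinuousLinearMap.id ℝ E + v i • M).det := by
    intro M
    obtain ⟨p, hp, hpe⟩ := exists_polynomial_eval_eq_det M
    have hdeg : p.degree < (Finset.range (n + 1)).card := by
      rw [Finset.card_range]
      exact (Polynomial.degree_le_of_natDegree_le hp).trans_lt (by exact_mod_cast n.lt_succ_self)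
    have := congrArg (Polynomial.eval 1) (Lagrange.eq_interpolate hvinj hdeg)
    rw [hpe 1, one_smul] at this
    rw [this, Lagrange.interpolate_apply, Polynomial.eval_finsetSum]
    refine Finset.sum_congr rfl fun i _ => ?_
    rw [Polynomial.eval_mul, Polynomial.eval_C, hpe, mul_comm]
  have hV : 0 < ν.real (ball (0 : E) 1) :=
    ENNReal.toReal_pos (measure_ball_pos ν 0 one_pos).ne' measure_ball_lt_top.ne
  have hintegrable : ∀ i ∈ Finset.range (n + 1), Integrable
      (fun x => c i * (ContinuousLinearMap.id ℝ E + v i • fderiv ℝ h x).det)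
      (ν.restrict (ball 0 1)) := by
    intro i _
    refine Integrable.const_mul ?_ _
    by_contra hni
    have := hint (v i) (hv i)
    rw [integral_undef hni] at this
    exact hV.ne this
  have hsum : ∫ x in ball (0 : E) 1, (ContinuousLinearMap.id ℝ E + fderiv ℝ h x).det ∂ν
      = ν.real (ball (0 : E) 1) := by
    rw [integral_congr_ae (.of_forall fun x => hinterp (fderiv ℝ h x)),
      integral_finsetSum _ hintegrable]
    simp_rw [MeasureTheory.integral_const_mul]
    rw [Finset.sum_congr rfl fun i _ => by rw [hint (v i) (hv i)], ← Finset.sum_mul, hc, one_mul]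
  have hsum0 := setIntegral_congr_fun (μ := ν) measurableSet_ball hzero
  rw [hsum, MeasureTheory.integral_zero] at hsum0
  exact hV.ne' hsum0

open Metric in
/-- There is no `C¹` retraction of the closed unit ball onto the unit sphere. -/
lemma not_exists_contDiffOn_retraction {E : Type*} [NormedAddCommGroup E]
    [InnerProductSpace ℝ E] [FiniteDimensional ℝ E] {r : E → E}
    (hr : ContDiffOn ℝ 1 r (closedBall 0 1)) (hnorm : ∀ x ∈ closedBall (0 : E) 1, ‖r x‖ = 1)
    (hfix : ∀ x ∈ sphere (0 : E) 1, r x = x) : False := by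
  classical
  obtain ⟨K, hK⟩ := (hr.sub contDiffOn_id).exists_lipschitzOnWith one_ne_zero
    (convex_closedBall 0 1) (isCompact_closedBall 0 1)
  let h : E → E := fun x => if ‖x‖ ≤ 1 then r x - x else 0
  have hin : ∀ x ∈ closedBall (0 : E) 1, h x = r x - x := fun x hx =>
    if_pos (by simpa using hx)
  have hs : ∀ x ∈ sphere (0 : E) 1, h x = 0 := fun x hx => by
    rw [hin x (sphere_subset_closedBall hx), hfix x hx, sub_self]
  have hout : ∀ x, 1 ≤ ‖x‖ → h x = 0 := fun x hx => by
    rcases hx.eq_or_lt with hx | hx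
    · exact hs x (by simpa using hx.symm)
    · exact if_neg (not_le.2 hx)
  have hlip : LipschitzWith K h := by
    refine lipschitzWith_of_closedBall_of_eq_zero (fun x hx y hy => ?_) hout
    rw [hin x hx, hin y hy]
    exact hK hx hy
  have hrd : ∀ x ∈ ball (0 : E) 1, DifferentiableAt ℝ r x := fun x hx =>
    (hr.differentiableOn one_ne_zero).differentiableAt
      (Filter.mem_of_superset (isOpen_ball.mem_nhds hx) ball_subset_closedBall)
  have hder : ∀ x ∈ ball (0 : E) 1, HasFDerivAt h (fderiv ℝ r x - ContinuousLinearMap.id ℝ E) x :=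
    fun x hx => ((hrd x hx).hasFDerivAt.sub (hasFDerivAt_id x)).congr_of_eventuallyEq
      (Filter.eventually_of_mem (isOpen_ball.mem_nhds hx)
        fun y hy => hin y (ball_subset_closedBall hy))
  obtain ⟨x, hx, hne⟩ := exists_det_id_add_fderiv_ne_zero hlip hout
    fun x hx => (hder x hx).differentiableAt
  rw [(hder x hx).fderiv, add_sub_cancel] at hne
  obtain ⟨w, hw⟩ := (LinearMap.equivOfDetNeZero (fderiv ℝ r x : E →ₗ[ℝ] E) hne).surjective (r x)
  have hw' : fderiv ℝ r x w = r x := hw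
  have h1 : HasFDerivAt (fun y => inner ℝ (r y) (r y)) (0 : E →L[ℝ] ℝ) x :=
    (hasFDerivAt_const (1 : ℝ) x).congr_of_eventuallyEq
      (Filter.eventually_of_mem (isOpen_ball.mem_nhds hx) fun y hy => by
        change inner ℝ (r y) (r y) = 1
        rw [real_inner_self_eq_norm_sq, hnorm y (ball_subset_closedBall hy), one_pow])
  have h2 := h1.unique ((hrd x hx).hasFDerivAt.inner ℝ (hrd x hx).hasFDerivAt)
  have h3 := congrArg (fun L : E →L[ℝ] ℝ => L w) h2
  simp [hw', hnorm x (ball_subset_closedBall hx)] at h3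
  norm_num at h3

open Metric in
/-- A `C¹` self-map of the closed unit ball has a fixed point. -/
lemma exists_fixedPoint_closedBall_of_contDiff {E : Type*} [NormedAddCommGroup E]
    [InnerProductSpace ℝ E] [FiniteDimensional ℝ E] {G : E → E} (hG : ContDiff ℝ 1 G)
    (hmaps : Set.MapsTo G (closedBall 0 1) (closedBall 0 1)) :
    ∃ x ∈ closedBall (0 : E) 1, G x = x := by
  by_contra! hne
  let d : E → E := fun x => x - G x
  let a : E → ℝ := fun x => inner ℝ (d x) (d x)
  let b : E → ℝ := fun x => inner ℝ x (d x)
  let c : E → ℝ := fun x => inner ℝ x x - 1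
  let q : E → ℝ := fun x => b x ^ 2 - a x * c x
  let s : E → ℝ := fun x => (-b x + √(q x)) / a x
  have hd : ContDiff ℝ 1 d := contDiff_id.sub hG
  have ha : ContDiff ℝ 1 a := hd.inner ℝ hd
  have hb : ContDiff ℝ 1 b := contDiff_id.inner ℝ hd
  have hc : ContDiff ℝ 1 c := (contDiff_id.inner ℝ contDiff_id).sub contDiff_const
  have hq : ContDiff ℝ 1 q := (hb.pow 2).sub (ha.mul hc)
  have ha0 : ∀ x ∈ closedBall (0 : E) 1, 0 < a x := fun x hx =>
    real_inner_self_pos.2 (sub_ne_zero.2 (hne x hx).symm)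
  have hb0 : ∀ x ∈ sphere (0 : E) 1, 0 < b x := by
    intro x hx
    have hx1 : ‖x‖ = 1 := by simpa using hx
    have hG1 : ‖G x‖ ≤ 1 := by simpa using hmaps (sphere_subset_closedBall hx)
    have hle : inner ℝ x (G x) ≤ 1 := (real_inner_le_norm x (G x)).trans (by rw [hx1]; linarith)
    have hlt : inner ℝ x (G x) ≠ 1 := by
      intro h
      apply hne x (sphere_subset_closedBall hx)
      have h2 : ‖x - G x‖ ^ 2 = ‖x‖ ^ 2 - 2 * inner ℝ x (G x) + ‖G x‖ ^ 2 := norm_sub_sq_real _ _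
      rw [h, hx1] at h2
      have : ‖x - G x‖ = 0 := by
        have := norm_nonneg (x - G x)
        have := norm_nonneg (G x)
        nlinarith
      exact (sub_eq_zero.1 (norm_eq_zero.1 this)).symm
    have : b x = 1 - inner ℝ x (G x) := by
      simp only [b, d, inner_sub_right, real_inner_self_eq_norm_sq, hx1, one_pow]
    rw [this]
    exact sub_pos.2 (lt_of_le_of_ne hle hlt)
  have hc_le : ∀ x ∈ closedBall (0 : E) 1, c x ≤ 0 := fun x hx => by
    have hx1 : ‖x‖ ≤ 1 := by simpa using hx
    simp only [c, real_inner_self_eq_norm_sq]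
    nlinarith [norm_nonneg x]
  have hc0 : ∀ x ∈ sphere (0 : E) 1, c x = 0 := fun x hx => by
    have hx1 : ‖x‖ = 1 := by simpa using hx
    simp [c, hx1]
  have hq0 : ∀ x ∈ closedBall (0 : E) 1, 0 < q x := by
    intro x hx
    by_cases hx1 : x ∈ sphere (0 : E) 1
    · simp only [q, hc0 x hx1, mul_zero, sub_zero]
      exact pow_pos (hb0 x hx1) 2
    · have : c x < 0 := by
        have h1 : ‖x‖ < 1 := lt_of_le_of_ne (by simpa using hx) (by simpa using hx1)
        simp only [c, real_inner_self_eq_norm_sq]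
        nlinarith [norm_nonneg x]
      have := mul_neg_of_pos_of_neg (ha0 x hx) this
      simp only [q]
      nlinarith [sq_nonneg (b x)]
  have hs : ContDiffOn ℝ 1 s (closedBall 0 1) :=
    (hb.contDiffOn.neg.add (hq.contDiffOn.sqrt fun x hx => (hq0 x hx).ne')).div ha.contDiffOn
      fun x hx => (ha0 x hx).ne'
  refine not_exists_contDiffOn_retraction (r := fun x => x + s x • d x)
    (contDiffOn_id.add (hs.smul hd.contDiffOn)) (fun x hx => ?_) fun x hx => ?_
  · have hsq := Real.sq_sqrt (hq0 x hx).le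
    have hsa : s x * a x = -b x + √(q x) := div_mul_cancel₀ _ (ha0 x hx).ne'
    have hroot : a x * (a x * s x ^ 2 + 2 * b x * s x + c x) = 0 := by
      have : a x * (a x * s x ^ 2 + 2 * b x * s x + c x) = (s x * a x + b x) ^ 2 - q x := by
        simp only [q]; ring
      rw [this, hsa, neg_add_cancel_comm, hsq, sub_self]
    have hroot' := (mul_eq_zero.1 hroot).resolve_left (ha0 x hx).ne'
    have hexp : inner ℝ (x + s x • d x) (x + s x • d x)
        = a x * s x ^ 2 + 2 * b x * s x + c x + 1 := by
      simp only [a, b, c, inner_add_left, inner_add_right, real_inner_smul_left,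
        real_inner_smul_right, real_inner_comm (d x) x]
      ring
    rw [hroot', zero_add, real_inner_self_eq_norm_sq] at hexp
    exact (pow_eq_one_iff_of_nonneg (norm_nonneg _) two_ne_zero).1 hexp
  · have : s x = 0 := by
      simp only [s, q, hc0 x hx, mul_zero, sub_zero, Real.sqrt_sq (hb0 x hx).le, neg_add_cancel,
        zero_div]
    simp [this]

open Metric in
/-- **Brouwer's fixed point theorem** for the closed unit ball. -/
theorem Continuous.exists_fixedPoint_closedBall {E : Type*} [NormedAddCommGroup E]
    [InnerProductSpace ℝ E] [FiniteDimensional ℝ E] {f : E → E} (hf : Continuous f)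
    (hmaps : Set.MapsTo f (closedBall 0 1) (closedBall 0 1)) :
    ∃ x ∈ closedBall (0 : E) 1, f x = x := by
  obtain ⟨x₀, hx₀, hmin⟩ := (isCompact_closedBall (0 : E) 1).exists_isMinOn
    (nonempty_closedBall.2 zero_le_one) (hf.sub continuous_id).norm.continuousOn
  by_contra! hne
  have hm : 0 < ‖f x₀ - x₀‖ := norm_pos_iff.2 (sub_ne_zero.2 (hne x₀ hx₀))
  obtain ⟨ε, hε, hε2⟩ : ∃ ε > 0, 2 * ε < ‖f x₀ - x₀‖ := ⟨‖f x₀ - x₀‖ / 3, by positivity, by linarith⟩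
  obtain ⟨g, hg, hgf, -⟩ := hf.exists_contDiff_approx 1 (continuous_const (y := ε)) fun _ => hε
  have hgn : ∀ x ∈ closedBall (0 : E) 1, ‖g x‖ ≤ 1 + ε := fun x hx => by
    have h1 : ‖f x‖ ≤ 1 := by simpa using hmaps hx
    have h2 := hgf x
    rw [dist_eq_norm] at h2
    linarith [norm_le_norm_add_norm_sub' (g x) (f x)]
  obtain ⟨x, hx, hxg⟩ := exists_fixedPoint_closedBall_of_contDiff (G := fun x => (1 + ε)⁻¹ • g x)
    (contDiff_const.smul (by exact_mod_cast hg)) fun x hx => by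
      rw [mem_closedBall_zero_iff, norm_smul, norm_inv, Real.norm_of_nonneg (by positivity),
        inv_mul_le_iff₀ (by positivity), mul_one]
      exact hgn x hx
  have hgx : g x = (1 + ε) • x := by
    rw [← hxg, smul_inv_smul₀ (by positivity), hxg]
  have hx1 : ‖x‖ ≤ 1 := by simpa using hx
  have h1 : ‖f x₀ - x₀‖ ≤ ‖f x - x‖ := hmin hx
  have h2 : f x - x = (f x - g x) + ε • x := by rw [hgx]; module
  have h3 := hgf x
  rw [dist_comm, dist_eq_norm] at h3
  have h4 : ‖f x - x‖ ≤ ‖f x - g x‖ + ε * ‖x‖ := by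
    rw [h2]
    refine (norm_add_le _ _).trans ?_
    rw [norm_smul, Real.norm_of_nonneg hε.le]
  nlinarith

open Metric in
/-- **Schauder's fixed point theorem** for a compact convex set. -/
theorem IsCompact.exists_fixedPoint_of_convex {E : Type*} [NormedAddCommGroup E]
    [NormedSpace ℝ E] {S : Set E} (hS : IsCompact S) (hconv : Convex ℝ S) (hne : S.Nonempty)
    {f : E → E} (hf : ContinuousOn f S) (hmaps : Set.MapsTo f S S) : ∃ x ∈ S, f x = x := by
  classical
  obtain ⟨x₀, hx₀, hmin⟩ := hS.exists_isMinOn hne (hf.sub continuousOn_id).norm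
  by_contra! hfix
  set ε := ‖f x₀ - x₀‖ with hεdef
  have hε : 0 < ε := norm_pos_iff.2 (sub_ne_zero.2 (hfix x₀ hx₀))
  obtain ⟨t, htS, htfin, hcover⟩ := hS.finite_cover_balls (half_pos hε)
  have : Fintype t := htfin.fintype
  obtain ⟨p₀, hp₀⟩ := hne
  let φ : t → E → ℝ := fun i x => max 0 (ε / 2 - ‖x - i‖)
  have hφc : ∀ i, Continuous (φ i) := fun i => by fun_prop
  have hφ0 : ∀ i x, 0 ≤ φ i x := fun i x => le_max_left _ _
  have hφsum : ∀ x ∈ S, 0 < ∑ i, φ i x := by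
    intro x hx
    obtain ⟨i, hi, hxi⟩ := Set.mem_iUnion₂.1 (hcover hx)
    rw [mem_ball, dist_eq_norm] at hxi
    exact Finset.sum_pos' (fun i _ => hφ0 i x)
      ⟨⟨i, hi⟩, Finset.mem_univ _, lt_max_of_lt_right (sub_pos.2 hxi)⟩
  let m : EuclideanSpace ℝ t → ℝ := fun w => ∑ i, max 0 (w i)
  let σ : EuclideanSpace ℝ t → E := fun w =>
    (max 1 (m w))⁻¹ • (max 0 (1 - m w) • p₀ + ∑ i, max 0 (w i) • (i : E))
  have hmc : Continuous m := by fun_prop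
  have hM : ∀ w, 0 < max 1 (m w) := fun w => lt_max_of_lt_left one_pos
  have hm0 : ∀ w, 0 ≤ m w := fun w => Finset.sum_nonneg fun i _ => le_max_left _ _
  have hσc : Continuous σ := by
    refine Continuous.smul ((continuous_const.max hmc).inv₀ fun w => (hM w).ne') ?_
    fun_prop
  have hσS : ∀ w, σ w ∈ S := by
    intro w
    have hw : σ w = ∑ o : Option t, (o.elim ((max 1 (m w))⁻¹ * max 0 (1 - m w))
        fun i => (max 1 (m w))⁻¹ * max 0 (w i)) • (o.elim p₀ fun i => (i : E)) := by
      simp only [σ, Fintype.sum_option, Option.elim, smul_add, Finset.smul_sum, smul_smul]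
    rw [hw]
    refine hconv.sum_mem ?_ ?_ ?_
    · rintro (_ | i) - <;> simp only [Option.elim]
      · exact mul_nonneg (inv_nonneg.2 (hM w).le) (le_max_left _ _)
      · exact mul_nonneg (inv_nonneg.2 (hM w).le) (le_max_left _ _)
    · simp only [Fintype.sum_option, Option.elim, ← Finset.mul_sum, ← mul_add]
      rw [inv_mul_eq_one₀ (hM w).ne']
      change max 1 (m w) = max 0 (1 - m w) + m w
      rcases le_total 1 (m w) with h | h
      · rw [max_eq_right h, max_eq_left (by linarith)]; ring
      · rw [max_eq_left h, max_eq_right (by linarith)]; ring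
    · rintro (_ | i) - <;> simp only [Option.elim]
      · exact hp₀
      · exact htS i.2
  let g : EuclideanSpace ℝ t → EuclideanSpace ℝ t := fun w =>
    WithLp.toLp 2 fun i => φ i (f (σ w)) / ∑ j, φ j (f (σ w))
  have hfσ : Continuous fun w => f (σ w) := hf.comp_continuous hσc hσS
  have hpos : ∀ w, 0 < ∑ j, φ j (f (σ w)) := fun w => hφsum _ (hmaps (hσS w))
  have hgc : Continuous g := by
    refine (PiLp.continuous_toLp 2 _).comp (continuous_pi fun i => ?_)
    exact ((hφc i).comp hfσ).div (continuous_finsetSum _ fun j _ => (hφc j).comp hfσ)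
      fun w => (hpos w).ne'
  have hg0 : ∀ w i, 0 ≤ g w i := fun w i => div_nonneg (hφ0 _ _) (hpos w).le
  have hg1 : ∀ w, ∑ i, g w i = 1 := fun w => by
    simp only [g]
    rw [← Finset.sum_div, div_self (hpos w).ne']
  obtain ⟨w, -, hw⟩ := hgc.exists_fixedPoint_closedBall fun w _ => by
    rw [mem_closedBall_zero_iff, EuclideanSpace.norm_eq, Real.sqrt_le_one]
    calc ∑ i, ‖g w i‖ ^ 2 ≤ ∑ i, g w i := Finset.sum_le_sum fun i _ => by
          have : g w i ≤ 1 := by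
            rw [← hg1 w]
            exact Finset.single_le_sum (fun j _ => hg0 w j) (Finset.mem_univ i)
          rw [Real.norm_of_nonneg (hg0 w i)]
          nlinarith [hg0 w i]
      _ = 1 := hg1 w
  have hw0 : ∀ i, 0 ≤ w i := fun i => by rw [← hw]; exact hg0 w i
  have hw1 : ∑ i, w i = 1 := by rw [← hg1 w, hw]
  have hm1 : m w = 1 := by
    simp only [m]
    rw [← hw1]
    exact Finset.sum_congr rfl fun i _ => max_eq_right (hw0 i)
  have hσw : σ w = ∑ i, w i • (i : E) := by
    simp only [σ, hm1, max_self, inv_one, sub_self, zero_smul, zero_add, one_smul]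
    exact Finset.sum_congr rfl fun i _ => by rw [max_eq_right (hw0 i)]
  have hdiff : f (σ w) - σ w = ∑ i, w i • (f (σ w) - (i : E)) := by
    simp only [smul_sub, Finset.sum_sub_distrib, ← Finset.sum_smul, hw1, one_smul, ← hσw]
  have hle : ‖f (σ w) - σ w‖ ≤ ε / 2 := by
    rw [hdiff]
    calc ‖∑ i, w i • (f (σ w) - (i : E))‖ ≤ ∑ i, w i * (ε / 2) := by
          refine norm_sum_le_of_le _ fun i _ => ?_
          rw [norm_smul, Real.norm_of_nonneg (hw0 i)]
          rcases (hw0 i).eq_or_lt with h | h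
          · rw [← h, zero_mul, zero_mul]
          · refine mul_le_mul_of_nonneg_left ?_ h.le
            have hφi : φ i (f (σ w)) ≠ 0 := by
              intro h0
              have : g w i = 0 := by simp only [g, h0, zero_div]
              rw [hw] at this
              exact h.ne' this
            by_contra! hlt
            exact hφi (max_eq_left (by linarith))
      _ = ε / 2 := by rw [← Finset.sum_mul, hw1, one_mul]
  have : ε ≤ ‖f (σ w) - σ w‖ := hmin (hσS w)
  linarith

lemma continuous_of_abs_sub_le {X : Type*} [TopologicalSpace X] {w φ : X → ℝ} (hw : Continuous w)
    (hφ : ∀ s t, |φ t - φ s| ≤ |w t - w s|) : Continuous φ := by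
  refine continuous_iff_continuousAt.2 fun s => tendsto_iff_dist_tendsto_zero.2 ?_
  have h : Filter.Tendsto (fun t => |w t - w s|) (nhds s) (nhds 0) := by
    have : Continuous fun t => |w t - w s| := by fun_prop
    simpa using this.tendsto s
  exact squeeze_zero (fun _ => dist_nonneg) (fun t => hφ s t) h

/-- The bounded functions whose increments are dominated by those of `w`. -/
def dominatedSet {X : Type*} [TopologicalSpace X] (a : ℝ) (w : X → ℝ) : Set C(X, ℝ) :=
  {x | (∀ t, |x t| ≤ a) ∧ ∀ s t, |x t - x s| ≤ |w t - w s|}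

lemma isCompact_dominatedSet {X : Type*} [TopologicalSpace X] (a : ℝ) {w : X → ℝ}
    (hw : Continuous w) : IsCompact (dominatedSet a w) := by
  refine ArzelaAscoli.isCompact_of_equicontinuous _ ?_ ?_
  · have himage : ContinuousMap.toFun '' dominatedSet a w =
        {φ : X → ℝ | (∀ t, |φ t| ≤ a) ∧ ∀ s t, |φ t - φ s| ≤ |w t - w s|} := by
      ext φ
      constructor
      · rintro ⟨x, hx, rfl⟩
        exact hx
      · intro hφ
        exact ⟨⟨φ, continuous_of_abs_sub_le hw hφ.2⟩, hφ, rfl⟩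
    rw [himage]
    refine (isCompact_univ_pi fun _ => isCompact_Icc (a := -a) (b := a)).of_isClosed_subset ?_ ?_
    · simp only [Set.ofPred_and, Set.ofPred_forall]
      refine (isClosed_iInter fun t => ?_).inter
        (isClosed_iInter fun s => isClosed_iInter fun t => ?_)
      · exact isClosed_le (by fun_prop) continuous_const
      · exact isClosed_le (by fun_prop) continuous_const
    · exact fun φ hφ t _ => abs_le.1 (hφ.1 t)
  · intro s
    refine Metric.equicontinuousAt_of_continuity_modulus (fun t => |w t - w s|) ?_ _ ?_
    · have : Continuous fun t => |w t - w s| := by fun_prop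
      simpa using this.tendsto s
    · refine Filter.Eventually.of_forall fun t x => ?_
      rw [dist_comm]
      exact x.2.2 s t

lemma convex_dominatedSet {X : Type*} [TopologicalSpace X] (a : ℝ) (w : X → ℝ) :
    Convex ℝ (dominatedSet a w) := by
  intro x hx y hy c d hc hd hcd
  refine ⟨fun t => ?_, fun s t => ?_⟩
  · calc |c * x t + d * y t| ≤ c * |x t| + d * |y t| := by
          refine (abs_add_le _ _).trans_eq ?_
          rw [abs_mul, abs_mul, abs_of_nonneg hc, abs_of_nonneg hd]
      _ ≤ c * a + d * a := add_le_add (mul_le_mul_of_nonneg_left (hx.1 t) hc)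
        (mul_le_mul_of_nonneg_left (hy.1 t) hd)
      _ = a := by rw [← add_mul, hcd, one_mul]
  · calc |c * x t + d * y t - (c * x s + d * y s)|
        = |c * (x t - x s) + d * (y t - y s)| := by congr 1; ring
      _ ≤ c * |x t - x s| + d * |y t - y s| := by
          refine (abs_add_le _ _).trans_eq ?_
          rw [abs_mul, abs_mul, abs_of_nonneg hc, abs_of_nonneg hd]
      _ ≤ c * |w t - w s| + d * |w t - w s| := add_le_add
        (mul_le_mul_of_nonneg_left (hx.2 s t) hc) (mul_le_mul_of_nonneg_left (hy.2 s t) hd)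
      _ = |w t - w s| := by rw [← add_mul, hcd, one_mul]

lemma dominatedSet_nonempty {X : Type*} [TopologicalSpace X] {a : ℝ} (ha : 0 ≤ a) (w : X → ℝ) :
    (dominatedSet a w).Nonempty :=
  ⟨0, fun t => by simpa using ha, fun s t => by simp⟩

/-- The `ψ`-Riemann–Liouville integral of order `α`, without the factor `1 / Γ(α)`. -/
noncomputable def psiIntegral (ψ : ℝ → ℝ) (α : ℝ) (u : ℝ → ℝ) (t : ℝ) : ℝ :=
  ∫ s in (0:ℝ)..t, deriv ψ s * (ψ t - ψ s) ^ (α - 1) * u s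

section psiIntegral

variable {ψ : ℝ → ℝ} {α : ℝ}

lemma continuousOn_psiKernel (hd : ∀ t ∈ Icc (0 : ℝ) 1, DifferentiableAt ℝ ψ t)
    (hdc : ContinuousOn (deriv ψ) (Icc 0 1)) (hα : 1 < α) (t : ℝ) :
    ContinuousOn (fun s => deriv ψ s * (ψ t - ψ s) ^ (α - 1)) (Icc 0 1) :=
  hdc.mul ((continuousOn_const.sub fun s hs => (hd s hs).continuousAt.continuousWithinAt).rpow_const
    fun _ _ => Or.inr (by linarith))

lemma intervalIntegrable_of_continuousOn_unitInterval {h : ℝ → ℝ} (hh : ContinuousOn h (Icc 0 1))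
    {a b : ℝ} (ha : 0 ≤ a) (hab : a ≤ b) (hb : b ≤ 1) : IntervalIntegrable h volume a b :=
  (hh.mono (Icc_subset_Icc ha hb)).intervalIntegrable_of_Icc hab

lemma integral_psiKernel (hd : ∀ t ∈ Icc (0 : ℝ) 1, DifferentiableAt ℝ ψ t)
    (hdc : ContinuousOn (deriv ψ) (Icc 0 1)) (hα : 1 < α) {a b : ℝ} (t : ℝ) (ha : 0 ≤ a)
    (hab : a ≤ b) (hb : b ≤ 1) :
    ∫ s in a..b, deriv ψ s * (ψ t - ψ s) ^ (α - 1)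
      = ((ψ t - ψ a) ^ α - (ψ t - ψ b) ^ α) / α := by
  have h : ∀ s ∈ uIcc a b, HasDerivAt (fun s => -(ψ t - ψ s) ^ α / α)
      (deriv ψ s * (ψ t - ψ s) ^ (α - 1)) s := by
    intro s hs
    rw [uIcc_of_le hab] at hs
    have h1 := ((hd s ⟨ha.trans hs.1, hs.2.trans hb⟩).hasDerivAt.const_sub (ψ t)).rpow_const
      (p := α) (Or.inr hα.le)
    convert! (h1.neg.div_const α) using 1
    field_simp
  rw [integral_eq_sub_of_hasDerivAt h (intervalIntegrable_of_continuousOn_unitInterval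
    (continuousOn_psiKernel hd hdc hα t) ha hab hb)]
  ring

lemma abs_psiIntegral_sub_le (hmono : MonotoneOn ψ (Icc 0 1))
    (hd : ∀ t ∈ Icc (0 : ℝ) 1, DifferentiableAt ℝ ψ t)
    (hd0 : ∀ t ∈ Icc (0 : ℝ) 1, 0 ≤ deriv ψ t)
    (hdc : ContinuousOn (deriv ψ) (Icc 0 1)) (hα : 1 < α) {u : ℝ → ℝ}
    (hu : ContinuousOn u (Icc 0 1)) {C : ℝ} (hC : ∀ s ∈ Icc (0 : ℝ) 1, |u s| ≤ C) {s t : ℝ}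
    (hs : 0 ≤ s) (hst : s ≤ t) (ht : t ≤ 1) :
    |psiIntegral ψ α u t - psiIntegral ψ α u s|
      ≤ C * (((ψ t - ψ 0) ^ α - (ψ s - ψ 0) ^ α) / α) := by
  have hk := continuousOn_psiKernel hd hdc hα
  have hi : ∀ {h : ℝ → ℝ}, ContinuousOn h (Icc 0 1) → ∀ {a b : ℝ}, 0 ≤ a → a ≤ b → b ≤ 1 →
      IntervalIntegrable h volume a b := intervalIntegrable_of_continuousOn_unitInterval
  have hku : ∀ t, ContinuousOn (fun r => deriv ψ r * (ψ t - ψ r) ^ (α - 1) * u r) (Icc 0 1) :=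
    fun t => (hk t).mul hu
  have hkC : ContinuousOn (fun r => C * (deriv ψ r * (ψ t - ψ r) ^ (α - 1))) (Icc 0 1) :=
    continuousOn_const.mul (hk t)
  have hkkC : ContinuousOn (fun r => C * (deriv ψ r * (ψ t - ψ r) ^ (α - 1)
      - deriv ψ r * (ψ s - ψ r) ^ (α - 1))) (Icc 0 1) :=
    continuousOn_const.mul ((hk t).sub (hk s))
  have hs1 := hst.trans ht
  have hsplit : psiIntegral ψ α u t - psiIntegral ψ α u s =
      (∫ r in (0:ℝ)..s, (deriv ψ r * (ψ t - ψ r) ^ (α - 1) - deriv ψ r * (ψ s - ψ r) ^ (α - 1))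
        * u r) + ∫ r in s..t, deriv ψ r * (ψ t - ψ r) ^ (α - 1) * u r := by
    simp only [psiIntegral, sub_mul]
    rw [integral_sub (hi (hku t) le_rfl hs hs1) (hi (hku s) le_rfl hs hs1),
      ← integral_add_adjacent_intervals (hi (hku t) le_rfl hs hs1)
        (hi (hku t) hs hst ht)]
    ring
  have h1 : |∫ r in (0:ℝ)..s, (deriv ψ r * (ψ t - ψ r) ^ (α - 1)
      - deriv ψ r * (ψ s - ψ r) ^ (α - 1)) * u r| ≤ ∫ r in (0:ℝ)..s, C *
        (deriv ψ r * (ψ t - ψ r) ^ (α - 1) - deriv ψ r * (ψ s - ψ r) ^ (α - 1)) := by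
    rw [← Real.norm_eq_abs]
    refine intervalIntegral.norm_integral_le_of_norm_le hs (ae_of_all _ fun r hr => ?_)
      (hi hkkC le_rfl hs hs1)
    have hrI : r ∈ Icc (0 : ℝ) 1 := ⟨hr.1.le, hr.2.trans hs1⟩
    have h0 : 0 ≤ deriv ψ r * (ψ t - ψ r) ^ (α - 1) - deriv ψ r * (ψ s - ψ r) ^ (α - 1) := by
      rw [← mul_sub]
      refine mul_nonneg (hd0 r hrI) (sub_nonneg.2 ?_)
      exact Real.rpow_le_rpow (sub_nonneg.2 (hmono hrI ⟨hs, hs1⟩ hr.2))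
        (sub_le_sub_right (hmono ⟨hs, hs1⟩ ⟨hs.trans hst, ht⟩ hst) _) (by linarith)
    rw [norm_mul, Real.norm_of_nonneg h0, mul_comm]
    exact mul_le_mul_of_nonneg_right (hC r hrI) h0
  have h2 : |∫ r in s..t, deriv ψ r * (ψ t - ψ r) ^ (α - 1) * u r| ≤ ∫ r in s..t, C *
        (deriv ψ r * (ψ t - ψ r) ^ (α - 1)) := by
    rw [← Real.norm_eq_abs]
    refine intervalIntegral.norm_integral_le_of_norm_le hst (ae_of_all _ fun r hr => ?_)
      (hi hkC hs hst ht)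
    have hrI : r ∈ Icc (0 : ℝ) 1 := ⟨hs.trans hr.1.le, hr.2.trans ht⟩
    have h0 : 0 ≤ deriv ψ r * (ψ t - ψ r) ^ (α - 1) :=
      mul_nonneg (hd0 r hrI) (Real.rpow_nonneg
        (sub_nonneg.2 (hmono hrI ⟨hs.trans hst, ht⟩ hr.2)) _)
    rw [norm_mul, Real.norm_of_nonneg h0, mul_comm]
    exact mul_le_mul_of_nonneg_right (hC r hrI) h0
  rw [hsplit]
  refine (abs_add_le _ _).trans ((add_le_add h1 h2).trans_eq ?_)
  rw [intervalIntegral.integral_const_mul, intervalIntegral.integral_const_mul,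
    integral_sub (hi (hk t) le_rfl hs hs1) (hi (hk s) le_rfl hs hs1),
    integral_psiKernel hd hdc hα t le_rfl hs hs1, integral_psiKernel hd hdc hα s le_rfl hs hs1,
    integral_psiKernel hd hdc hα t hs hst ht, sub_self, sub_self,
    Real.zero_rpow (by linarith)]
  ring

lemma psiIntegral_sub (hd : ∀ t ∈ Icc (0 : ℝ) 1, DifferentiableAt ℝ ψ t)
    (hdc : ContinuousOn (deriv ψ) (Icc 0 1)) (hα : 1 < α) {u v : ℝ → ℝ}
    (hu : ContinuousOn u (Icc 0 1)) (hv : ContinuousOn v (Icc 0 1)) {t : ℝ}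
    (ht : t ∈ Icc (0 : ℝ) 1) :
    psiIntegral ψ α (fun s => u s - v s) t = psiIntegral ψ α u t - psiIntegral ψ α v t := by
  have hk := continuousOn_psiKernel hd hdc hα t
  simp only [psiIntegral, mul_sub]
  exact integral_sub
    (intervalIntegrable_of_continuousOn_unitInterval (hk.mul hu) le_rfl ht.1 ht.2)
    (intervalIntegrable_of_continuousOn_unitInterval (hk.mul hv) le_rfl ht.1 ht.2)

end psiIntegral

/-- The solution operator of the linear four-point boundary value problem. -/
noncomputable def fourPointOp (ψ : ℝ → ℝ) (α η lam Δ : ℝ) (u : ℝ → ℝ) (t : ℝ) : ℝ :=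
  (1 / Real.Gamma α) * psiIntegral ψ α u t
  + (1 / Δ) * ((1 / Real.Gamma α) * psiIntegral ψ α u 1
        - (lam / Real.Gamma α) * psiIntegral ψ α u η) * (ψ t - ψ 0)

/-- A function whose increments dominate those of `fourPointOp` applied to functions bounded
by one. -/
noncomputable def fourPointModulus (ψ : ℝ → ℝ) (α lam Δ : ℝ) (t : ℝ) : ℝ :=
  (1 / Real.Gamma (α + 1)) * ((ψ t - ψ 0) ^ α
    + ((lam + 1) / |Δ|) * (ψ 1 - ψ 0) ^ α * (ψ t - ψ 0))

section fourPointOp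

variable {ψ : ℝ → ℝ} {α η lam Δ : ℝ}

lemma continuousOn_fourPointModulus (hd : ∀ t ∈ Icc (0 : ℝ) 1, DifferentiableAt ℝ ψ t)
    (hα : 1 < α) : ContinuousOn (fourPointModulus ψ α lam Δ) (Icc 0 1) := by
  have hψ : ContinuousOn (fun t => ψ t - ψ 0) (Icc 0 1) :=
    ContinuousOn.sub (fun s hs => (hd s hs).continuousAt.continuousWithinAt) continuousOn_const
  exact continuousOn_const.mul ((hψ.rpow_const fun _ _ => Or.inr (by linarith)).add
    (continuousOn_const.mul hψ))

lemma fourPointModulus_zero (hα : 1 < α) : fourPointModulus ψ α lam Δ 0 = 0 := by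
  simp [fourPointModulus, Real.zero_rpow (by linarith : α ≠ 0)]

lemma fourPointOp_zero (u : ℝ → ℝ) : fourPointOp ψ α η lam Δ u 0 = 0 := by
  simp [fourPointOp, psiIntegral]

lemma fourPointModulus_one (h : 0 < ψ 1 - ψ 0) : fourPointModulus ψ α lam Δ 1 =
    (1 / Real.Gamma (α + 1)) *
      ((ψ 1 - ψ 0) ^ α + ((lam + 1) / |Δ|) * (ψ 1 - ψ 0) ^ (α + 1)) := by
  rw [fourPointModulus, Real.rpow_add_one h.ne', mul_assoc ((lam + 1) / |Δ|)]

lemma monotoneOn_fourPointModulus (hmono : MonotoneOn ψ (Icc 0 1)) (hα : 1 < α) (hlam : 0 < lam) :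
    MonotoneOn (fourPointModulus ψ α lam Δ) (Icc 0 1) := by
  intro s hs t ht hst
  have h0 : (0 : ℝ) ∈ Icc (0 : ℝ) 1 := by simp
  have h1 : (1 : ℝ) ∈ Icc (0 : ℝ) 1 := by simp
  have hs0 : 0 ≤ ψ s - ψ 0 := sub_nonneg.2 (hmono h0 hs hs.1)
  have h10 : 0 ≤ ψ 1 - ψ 0 := sub_nonneg.2 (hmono h0 h1 zero_le_one)
  have hle := hmono hs ht hst
  have hΓ : 0 < Real.Gamma (α + 1) := Real.Gamma_pos_of_pos (by linarith)
  unfold fourPointModulus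
  gcongr

lemma fourPointOp_sub (hd : ∀ t ∈ Icc (0 : ℝ) 1, DifferentiableAt ℝ ψ t)
    (hdc : ContinuousOn (deriv ψ) (Icc 0 1)) (hα : 1 < α) (hη : η ∈ Icc (0 : ℝ) 1) {u v : ℝ → ℝ}
    (hu : ContinuousOn u (Icc 0 1)) (hv : ContinuousOn v (Icc 0 1)) {t : ℝ}
    (ht : t ∈ Icc (0 : ℝ) 1) :
    fourPointOp ψ α η lam Δ (fun s => u s - v s) t
      = fourPointOp ψ α η lam Δ u t - fourPointOp ψ α η lam Δ v t := by
  have hsub := fun {t : ℝ} (ht : t ∈ Icc (0 : ℝ) 1) => psiIntegral_sub hd hdc hα hu hv ht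
  rw [fourPointOp, hsub ht, hsub hη, hsub (by simp), fourPointOp, fourPointOp]
  ring

lemma abs_fourPointOp_sub_le_of_le (hmono : MonotoneOn ψ (Icc 0 1))
    (hd : ∀ t ∈ Icc (0 : ℝ) 1, DifferentiableAt ℝ ψ t)
    (hd0 : ∀ t ∈ Icc (0 : ℝ) 1, 0 ≤ deriv ψ t)
    (hdc : ContinuousOn (deriv ψ) (Icc 0 1)) (hα : 1 < α) (hη : η ∈ Icc (0 : ℝ) 1)
    (hlam : 0 < lam) {u : ℝ → ℝ} (hu : ContinuousOn u (Icc 0 1)) {C : ℝ}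
    (hC : ∀ s ∈ Icc (0 : ℝ) 1, |u s| ≤ C) {s t : ℝ} (hs : 0 ≤ s) (hst : s ≤ t) (ht : t ≤ 1) :
    |fourPointOp ψ α η lam Δ u t - fourPointOp ψ α η lam Δ u s|
      ≤ C * (fourPointModulus ψ α lam Δ t - fourPointModulus ψ α lam Δ s) := by
  have h0 : (0 : ℝ) ∈ Icc (0 : ℝ) 1 := by simp
  have h1 : (1 : ℝ) ∈ Icc (0 : ℝ) 1 := by simp
  have hα0 : 0 < α := by linarith
  have hC0 : 0 ≤ C := (abs_nonneg _).trans (hC 0 h0)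
  have hinc := fun {s t : ℝ} (hs : 0 ≤ s) (hst : s ≤ t) (ht : t ≤ 1) =>
    abs_psiIntegral_sub_le hmono hd hd0 hdc hα hu hC hs hst ht
  have hzero : psiIntegral ψ α u 0 = 0 := integral_same
  have hbound : ∀ r ∈ Icc (0 : ℝ) 1, |psiIntegral ψ α u r| ≤ C * ((ψ 1 - ψ 0) ^ α / α) := by
    intro r hr
    have := hinc le_rfl hr.1 hr.2
    rw [hzero, sub_self, Real.zero_rpow hα0.ne', sub_zero, sub_zero] at this
    refine this.trans ?_
    have h2 : 0 ≤ ψ r - ψ 0 := sub_nonneg.2 (hmono h0 hr hr.1)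
    have h3 : ψ r ≤ ψ 1 := hmono hr h1 hr.2
    gcongr
  have hΓ : 0 < Real.Gamma α := Real.Gamma_pos_of_pos hα0
  have hψst : 0 ≤ ψ t - ψ s := sub_nonneg.2 (hmono ⟨hs, hst.trans ht⟩ ⟨hs.trans hst, ht⟩ hst)
  have hdiff : fourPointOp ψ α η lam Δ u t - fourPointOp ψ α η lam Δ u s =
      (1 / Real.Gamma α) * ((psiIntegral ψ α u t - psiIntegral ψ α u s)
        + (1 / Δ) * (psiIntegral ψ α u 1 - lam * psiIntegral ψ α u η) * (ψ t - ψ s)) := by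
    simp only [fourPointOp]
    ring
  have hmid : |psiIntegral ψ α u 1 - lam * psiIntegral ψ α u η|
      ≤ (lam + 1) * (C * ((ψ 1 - ψ 0) ^ α / α)) := by
    refine (abs_sub _ _).trans ?_
    rw [abs_mul, abs_of_pos hlam]
    have := mul_le_mul_of_nonneg_left (hbound η hη) hlam.le
    linarith [hbound 1 h1]
  rw [hdiff, abs_mul, abs_of_pos (by positivity : 0 < 1 / Real.Gamma α)]
  calc 1 / Real.Gamma α * |(psiIntegral ψ α u t - psiIntegral ψ α u s)
        + (1 / Δ) * (psiIntegral ψ α u 1 - lam * psiIntegral ψ α u η) * (ψ t - ψ s)|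
      ≤ 1 / Real.Gamma α * (C * (((ψ t - ψ 0) ^ α - (ψ s - ψ 0) ^ α) / α)
        + (1 / |Δ|) * ((lam + 1) * (C * ((ψ 1 - ψ 0) ^ α / α))) * (ψ t - ψ s)) := by
        refine mul_le_mul_of_nonneg_left ((abs_add_le _ _).trans
          (add_le_add (hinc hs hst ht) ?_)) (by positivity)
        rw [abs_mul, abs_mul, abs_of_nonneg hψst, abs_div, abs_one]
        gcongr
    _ = C * (fourPointModulus ψ α lam Δ t - fourPointModulus ψ α lam Δ s) := by
        simp only [fourPointModulus, Real.Gamma_add_one hα0.ne']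
        field_simp
        ring

lemma abs_fourPointOp_sub_le (hmono : MonotoneOn ψ (Icc 0 1))
    (hd : ∀ t ∈ Icc (0 : ℝ) 1, DifferentiableAt ℝ ψ t)
    (hd0 : ∀ t ∈ Icc (0 : ℝ) 1, 0 ≤ deriv ψ t)
    (hdc : ContinuousOn (deriv ψ) (Icc 0 1)) (hα : 1 < α) (hη : η ∈ Icc (0 : ℝ) 1)
    (hlam : 0 < lam) {u : ℝ → ℝ} (hu : ContinuousOn u (Icc 0 1)) {C : ℝ}
    (hC : ∀ s ∈ Icc (0 : ℝ) 1, |u s| ≤ C) {s t : ℝ} (hs : s ∈ Icc (0 : ℝ) 1)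
    (ht : t ∈ Icc (0 : ℝ) 1) :
    |fourPointOp ψ α η lam Δ u t - fourPointOp ψ α η lam Δ u s|
      ≤ |C * fourPointModulus ψ α lam Δ t - C * fourPointModulus ψ α lam Δ s| := by
  rw [← mul_sub]
  rcases le_total s t with h | h
  · exact (abs_fourPointOp_sub_le_of_le hmono hd hd0 hdc hα hη hlam hu hC hs.1 h ht.2).trans
      (le_abs_self _)
  · rw [abs_sub_comm]
    refine (abs_fourPointOp_sub_le_of_le (Δ := Δ) hmono hd hd0 hdc hα hη hlam hu hC
      ht.1 h hs.2).trans ((le_abs_self _).trans_eq ?_)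
    rw [← neg_sub (fourPointModulus ψ α lam Δ t), mul_neg, abs_neg]

lemma abs_fourPointOp_le (hmono : MonotoneOn ψ (Icc 0 1))
    (hd : ∀ t ∈ Icc (0 : ℝ) 1, DifferentiableAt ℝ ψ t)
    (hd0 : ∀ t ∈ Icc (0 : ℝ) 1, 0 ≤ deriv ψ t)
    (hdc : ContinuousOn (deriv ψ) (Icc 0 1)) (hα : 1 < α) (hη : η ∈ Icc (0 : ℝ) 1)
    (hlam : 0 < lam) {u : ℝ → ℝ} (hu : ContinuousOn u (Icc 0 1)) {C : ℝ}
    (hC : ∀ s ∈ Icc (0 : ℝ) 1, |u s| ≤ C) {t : ℝ} (ht : t ∈ Icc (0 : ℝ) 1) :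
    |fourPointOp ψ α η lam Δ u t| ≤ C * fourPointModulus ψ α lam Δ 1 := by
  have hC0 : 0 ≤ C := (abs_nonneg _).trans (hC 0 (by simp))
  have h := abs_fourPointOp_sub_le_of_le (Δ := Δ) hmono hd hd0 hdc hα hη hlam hu hC le_rfl
    ht.1 ht.2
  rw [fourPointOp_zero, fourPointModulus_zero hα, sub_zero, sub_zero] at h
  exact h.trans (mul_le_mul_of_nonneg_left
    (monotoneOn_fourPointModulus hmono hα hlam ht (by simp) ht.2) hC0)

/-- `fourPointOp` induces a continuous operator on `C([0,1], ℝ)`. -/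
lemma exists_continuous_fourPointOp (hmono : MonotoneOn ψ (Icc 0 1))
    (hd : ∀ t ∈ Icc (0 : ℝ) 1, DifferentiableAt ℝ ψ t)
    (hd0 : ∀ t ∈ Icc (0 : ℝ) 1, 0 ≤ deriv ψ t)
    (hdc : ContinuousOn (deriv ψ) (Icc 0 1)) (hα : 1 < α) (hη : η ∈ Icc (0 : ℝ) 1)
    (hlam : 0 < lam) :
    ∃ J : C(Icc (0 : ℝ) 1, ℝ) → C(Icc (0 : ℝ) 1, ℝ), Continuous J ∧ ∀ u (t : Icc (0 : ℝ) 1),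
      J u t = fourPointOp ψ α η lam Δ (IccExtend zero_le_one u) t := by
  have hext : ∀ u : C(Icc (0 : ℝ) 1, ℝ), ContinuousOn (IccExtend zero_le_one u) (Icc 0 1) :=
    fun u => u.continuous.Icc_extend'.continuousOn
  have hW : Continuous fun t : Icc (0 : ℝ) 1 => fourPointModulus ψ α lam Δ t :=
    continuousOn_iff_continuous_domRestrict.1 (continuousOn_fourPointModulus hd hα)
  let J : C(Icc (0 : ℝ) 1, ℝ) → C(Icc (0 : ℝ) 1, ℝ) := fun u =>
    ⟨fun t => fourPointOp ψ α η lam Δ (IccExtend zero_le_one u) t,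
      continuous_of_abs_sub_le (continuous_const.mul hW) fun s t =>
        abs_fourPointOp_sub_le hmono hd hd0 hdc hα hη hlam (hext u)
          (fun r _ => u.norm_coe_le_norm (projIcc 0 1 zero_le_one r)) s.2 t.2⟩
  refine ⟨J, ?_, fun _ _ => rfl⟩
  have hW1 : 0 ≤ fourPointModulus ψ α lam Δ 1 := by
    rw [← fourPointModulus_zero (ψ := ψ) (lam := lam) (Δ := Δ) hα]
    exact monotoneOn_fourPointModulus hmono hα hlam (by simp) (by simp) zero_le_one
  refine (LipschitzWith.of_dist_le_mul (K := (fourPointModulus ψ α lam Δ 1).toNNReal)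
    fun u v => ?_).continuous
  rw [Real.coe_toNNReal _ hW1]
  rw [ContinuousMap.dist_le (mul_nonneg hW1 dist_nonneg)]
  intro t
  rw [Real.dist_eq]
  change |fourPointOp ψ α η lam Δ (IccExtend zero_le_one u) t
    - fourPointOp ψ α η lam Δ (IccExtend zero_le_one v) t| ≤ _
  rw [← fourPointOp_sub hd hdc hα hη (hext u) (hext v) t.2]
  refine (abs_fourPointOp_le hmono hd hd0 hdc hα hη hlam ((hext u).sub (hext v))
    (fun r _ => ?_) t.2).trans_eq (mul_comm _ _)
  exact ContinuousMap.dist_apply_le_dist (f := u) (g := v) (projIcc 0 1 zero_le_one r)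

end fourPointOp

lemma exists_nonneg_solution_of_column_sums_lt_one {p q r s c d : ℝ} (hq : 0 ≤ q)
    (hr : 0 ≤ r) (hc : 0 ≤ c) (hd : 0 ≤ d) (h₁ : p + r < 1) (h₂ : q + s < 1) :
    ∃ a b : ℝ, 0 ≤ a ∧ 0 ≤ b ∧ c + p * a + q * b = a ∧ d + r * a + s * b = b := by
  have hdet : 0 < (1 - p) * (1 - s) - q * r := by nlinarith
  have hp1 : 0 ≤ 1 - p := by linarith
  have hs1 : 0 ≤ 1 - s := by linarith
  obtain ⟨D, hD⟩ : ∃ D, D = (1 - p) * (1 - s) - q * r := ⟨_, rfl⟩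
  rw [← hD] at hdet
  refine ⟨((1 - s) * c + q * d) / D, ((1 - p) * d + r * c) / D, by positivity, by positivity,
    ?_, ?_⟩
  · field_simp
    rw [hD]
    ring
  · field_simp
    rw [hD]
    ring

/-- A function of `(t, x, y)` continuous on `[0,1] × ℝ²` induces a continuous superposition
operator on `C([0,1], ℝ)²`. -/
lemma exists_continuous_superposition {f : ℝ → ℝ → ℝ → ℝ}
    (hf : ContinuousOn (fun p : ℝ × ℝ × ℝ => f p.1 p.2.1 p.2.2)
      (Icc 0 1 ×ˢ (univ : Set (ℝ × ℝ)))) :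
    ∃ N : C(Icc (0 : ℝ) 1, ℝ) × C(Icc (0 : ℝ) 1, ℝ) → C(Icc (0 : ℝ) 1, ℝ), Continuous N ∧
      ∀ z t, N z t = f t (z.1 t) (z.2 t) := by
  have hc : Continuous fun p : (C(Icc (0 : ℝ) 1, ℝ) × C(Icc (0 : ℝ) 1, ℝ)) × Icc (0 : ℝ) 1 =>
      f p.2 (p.1.1 p.2) (p.1.2 p.2) :=
    hf.comp_continuous (f := fun p : (C(Icc (0 : ℝ) 1, ℝ) × C(Icc (0 : ℝ) 1, ℝ)) × Icc (0 : ℝ) 1 =>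
      ((p.2 : ℝ), p.1.1 p.2, p.1.2 p.2)) (by fun_prop) fun p => ⟨p.2.2, trivial⟩
  exact ⟨fun z => ⟨fun t => f t (z.1 t) (z.2 t), hc.comp (Continuous.prodMk_right z)⟩,
    ContinuousMap.continuous_of_continuous_uncurry _ hc, fun _ _ => rfl⟩

lemma Tmap_congr {ψ : ℝ → ℝ} {α η lam Δ : ℝ} {f : ℝ → ℝ → ℝ → ℝ} {x y u : ℝ → ℝ}
    (h : ∀ s ∈ Icc (0 : ℝ) 1, f s (x s) (y s) = u s) (hη : η ∈ Icc (0 : ℝ) 1) {t : ℝ}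
    (ht : t ∈ Icc (0 : ℝ) 1) :
    Tmap ψ α η lam Δ f x y t = fourPointOp ψ α η lam Δ u t := by
  have hint : ∀ r ∈ Icc (0 : ℝ) 1,
      (∫ s in (0:ℝ)..r, deriv ψ s * (ψ r - ψ s) ^ (α - 1) * f s (x s) (y s))
        = psiIntegral ψ α u r := fun r hr => by
    refine integral_congr fun s hs => ?_
    rw [uIcc_of_le hr.1] at hs
    simp only [h s ⟨hs.1, hs.2.trans hr.2⟩]
  rw [Tmap, fourPointOp, hint t ht, hint η hη, hint 1 (by simp)]

/-- **Existence theorem (Theorem 3.2 of the paper, via the Leray–Schauder alternative).**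
Under the growth assumption (A2), if `Ω* = max{Ω₁,Ω₂} < 1` then the coupled four-point
boundary value problem has at least one solution on `[0,1]`, i.e. there exists a pair of
continuous functions `x, y : [0,1] → ℝ` with `x = T₁(x,y)` and `y = T₂(x,y)` on `[0,1]`. -/
theorem existence_of_solution_of_coupled_system
    (α β η ξ lam μ Δ₁ Δ₂ : ℝ) (ψ : ℝ → ℝ) (f g : ℝ → ℝ → ℝ → ℝ)
    (hψmono : StrictMonoOn ψ (Icc 0 1))
    (hψC1 : ContDiffOn ℝ 1 ψ (Icc 0 1))
    (hψ' : ∀ t ∈ Icc (0:ℝ) 1, deriv ψ t ≠ 0)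
    (hα1 : 1 < α) (hα2 : α < 2) (hβ1 : 1 < β) (hβ2 : β < 2)
    (hη0 : 0 < η) (hη1 : η < 1) (hξ0 : 0 < ξ) (hξ1 : ξ < 1)
    (hlam : 0 < lam) (hμ : 0 < μ)
    (hΔ₁ : Δ₁ = lam * (ψ η - ψ 0) - (ψ 1 - ψ 0)) (hΔ₁0 : Δ₁ ≠ 0)
    (hΔ₂ : Δ₂ = μ * (ψ ξ - ψ 0) - (ψ 1 - ψ 0)) (hΔ₂0 : Δ₂ ≠ 0)
    (hfc : ContinuousOn (fun p : ℝ × ℝ × ℝ => f p.1 p.2.1 p.2.2)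
      (Icc 0 1 ×ˢ (univ : Set (ℝ × ℝ))))
    (hgc : ContinuousOn (fun p : ℝ × ℝ × ℝ => g p.1 p.2.1 p.2.2)
      (Icc 0 1 ×ˢ (univ : Set (ℝ × ℝ))))
    (k₀ k₁ k₂ l₀ l₁ l₂ : ℝ)
    (hk₀ : 0 < k₀) (hl₀ : 0 < l₀)
    (hk₁ : 0 ≤ k₁) (hk₂ : 0 ≤ k₂) (hl₁ : 0 ≤ l₁) (hl₂ : 0 ≤ l₂)
    (hfg : ∀ t ∈ Icc (0:ℝ) 1, ∀ u v : ℝ, |f t u v| ≤ k₀ + k₁ * |u| + k₂ * |v|)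
    (hgg : ∀ t ∈ Icc (0:ℝ) 1, ∀ u v : ℝ, |g t u v| ≤ l₀ + l₁ * |u| + l₂ * |v|)
    (A B Ω₁ Ω₂ Ωstar : ℝ)
    (hA : A = (1 / Real.Gamma (α + 1)) *
      ((ψ 1 - ψ 0) ^ α + ((lam + 1) / |Δ₁|) * (ψ 1 - ψ 0) ^ (α + 1)))
    (hB : B = (1 / Real.Gamma (β + 1)) *
      ((ψ 1 - ψ 0) ^ β + ((μ + 1) / |Δ₂|) * (ψ 1 - ψ 0) ^ (β + 1)))
    (hΩ₁ : Ω₁ = A * k₁ + B * l₁)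
    (hΩ₂ : Ω₂ = A * k₂ + B * l₂)
    (hΩstar : Ωstar = max Ω₁ Ω₂)
    (hΩlt : Ωstar < 1) :
    ∃ x y : ℝ → ℝ,
      ContinuousOn x (Icc 0 1) ∧ ContinuousOn y (Icc 0 1) ∧
      ∀ t ∈ Icc (0:ℝ) 1,
        x t = Tmap ψ α η lam Δ₁ f x y t ∧ y t = Tmap ψ β ξ μ Δ₂ g x y t := by
  have h0 : (0 : ℝ) ∈ Icc (0 : ℝ) 1 := by simp
  have h1 : (1 : ℝ) ∈ Icc (0 : ℝ) 1 := by simp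
  have hη : η ∈ Icc (0 : ℝ) 1 := ⟨hη0.le, hη1.le⟩
  have hξ : ξ ∈ Icc (0 : ℝ) 1 := ⟨hξ0.le, hξ1.le⟩
  have hmono := hψmono.monotoneOn
  have hd : ∀ t ∈ Icc (0 : ℝ) 1, DifferentiableAt ℝ ψ t := fun t ht =>
    differentiableAt_of_deriv_ne_zero (hψ' t ht)
  have hderiv : ∀ t ∈ Icc (0 : ℝ) 1, deriv ψ t = derivWithin ψ (Icc 0 1) t := fun t ht =>
    ((hd t ht).derivWithin (uniqueDiffOn_Icc_zero_one t ht)).symm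
  have hdc : ContinuousOn (deriv ψ) (Icc 0 1) :=
    (hψC1.continuousOn_derivWithin uniqueDiffOn_Icc_zero_one le_rfl).congr hderiv
  have hd0 : ∀ t ∈ Icc (0 : ℝ) 1, 0 ≤ deriv ψ t := fun t ht => by
    rw [hderiv t ht]
    exact hmono.derivWithin_nonneg
  have hψ10 : 0 < ψ 1 - ψ 0 := sub_pos.2 (hψmono h0 h1 one_pos)
  rw [← fourPointModulus_one hψ10] at hA hB
  have hA0 : 0 ≤ A := by
    rw [hA, ← fourPointModulus_zero (ψ := ψ) (lam := lam) (Δ := Δ₁) hα1]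
    exact monotoneOn_fourPointModulus hmono hα1 hlam h0 h1 zero_le_one
  have hB0 : 0 ≤ B := by
    rw [hB, ← fourPointModulus_zero (ψ := ψ) (lam := μ) (Δ := Δ₂) hβ1]
    exact monotoneOn_fourPointModulus hmono hβ1 hμ h0 h1 zero_le_one
  have hΩ₁lt : A * k₁ + B * l₁ < 1 := hΩ₁ ▸ (le_max_left _ _).trans_lt (hΩstar ▸ hΩlt)
  have hΩ₂lt : A * k₂ + B * l₂ < 1 := hΩ₂ ▸ (le_max_right _ _).trans_lt (hΩstar ▸ hΩlt)
  obtain ⟨a, b, ha, hb, hab₁, hab₂⟩ := exists_nonneg_solution_of_column_sums_lt_one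
    (mul_nonneg hA0 hk₂) (mul_nonneg hB0 hl₁)
    (mul_nonneg hA0 hk₀.le) (mul_nonneg hB0 hl₀.le) hΩ₁lt hΩ₂lt
  obtain ⟨J₁, hJ₁c, hJ₁⟩ := exists_continuous_fourPointOp (Δ := Δ₁) hmono hd hd0 hdc hα1 hη hlam
  obtain ⟨J₂, hJ₂c, hJ₂⟩ := exists_continuous_fourPointOp (Δ := Δ₂) hmono hd hd0 hdc hβ1 hξ hμ
  obtain ⟨F, hFc, hF⟩ := exists_continuous_superposition hfc
  obtain ⟨G, hGc, hG⟩ := exists_continuous_superposition hgc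
  set C₁ := k₀ + k₁ * a + k₂ * b
  set C₂ := l₀ + l₁ * a + l₂ * b
  let S := dominatedSet a (fun t : Icc (0 : ℝ) 1 => C₁ * fourPointModulus ψ α lam Δ₁ t) ×ˢ
    dominatedSet b (fun t : Icc (0 : ℝ) 1 => C₂ * fourPointModulus ψ β μ Δ₂ t)
  have hext : ∀ u : C(Icc (0 : ℝ) 1, ℝ), ContinuousOn (IccExtend zero_le_one u) (Icc 0 1) :=
    fun u => u.continuous.Icc_extend'.continuousOn
  have hScomp : IsCompact S :=
    (isCompact_dominatedSet a (continuous_const.mul (continuousOn_iff_continuous_domRestrict.1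
      (continuousOn_fourPointModulus hd hα1)))).prod
    (isCompact_dominatedSet b (continuous_const.mul (continuousOn_iff_continuous_domRestrict.1
      (continuousOn_fourPointModulus hd hβ1))))
  have hmaps : MapsTo (fun z => (J₁ (F z), J₂ (G z))) S S := by
    intro z hz
    have hFb : ∀ s ∈ Icc (0 : ℝ) 1, |IccExtend zero_le_one (F z) s| ≤ C₁ := by
      intro s _
      rw [IccExtend, Function.comp_apply, hF]
      refine (hfg _ (Subtype.prop _) _ _).trans ?_
      have := mul_le_mul_of_nonneg_left (hz.1.1 (projIcc 0 1 zero_le_one s)) hk₁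
      have := mul_le_mul_of_nonneg_left (hz.2.1 (projIcc 0 1 zero_le_one s)) hk₂
      linarith
    have hGb : ∀ s ∈ Icc (0 : ℝ) 1, |IccExtend zero_le_one (G z) s| ≤ C₂ := by
      intro s _
      rw [IccExtend, Function.comp_apply, hG]
      refine (hgg _ (Subtype.prop _) _ _).trans ?_
      have := mul_le_mul_of_nonneg_left (hz.1.1 (projIcc 0 1 zero_le_one s)) hl₁
      have := mul_le_mul_of_nonneg_left (hz.2.1 (projIcc 0 1 zero_le_one s)) hl₂
      linarith
    refine ⟨⟨fun t => ?_, fun s t => ?_⟩, ⟨fun t => ?_, fun s t => ?_⟩⟩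
    · rw [hJ₁]
      refine (abs_fourPointOp_le hmono hd hd0 hdc hα1 hη hlam (hext _) hFb t.2).trans_eq ?_
      rw [← hA]
      linear_combination hab₁
    · rw [hJ₁, hJ₁]
      exact abs_fourPointOp_sub_le hmono hd hd0 hdc hα1 hη hlam (hext _) hFb s.2 t.2
    · rw [hJ₂]
      refine (abs_fourPointOp_le hmono hd hd0 hdc hβ1 hξ hμ (hext _) hGb t.2).trans_eq ?_
      rw [← hB]
      linear_combination hab₂
    · rw [hJ₂, hJ₂]
      exact abs_fourPointOp_sub_le hmono hd hd0 hdc hβ1 hξ hμ (hext _) hGb s.2 t.2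
  obtain ⟨z, -, hz⟩ := hScomp.exists_fixedPoint_of_convex
    ((convex_dominatedSet _ _).prod (convex_dominatedSet _ _))
    ((dominatedSet_nonempty ha _).prod (dominatedSet_nonempty hb _))
    ((hJ₁c.comp hFc).prodMk (hJ₂c.comp hGc)).continuousOn hmaps
  refine ⟨IccExtend zero_le_one z.1, IccExtend zero_le_one z.2, hext _, hext _, fun t ht => ?_⟩
  have hfF : ∀ s ∈ Icc (0 : ℝ) 1, f s (IccExtend zero_le_one z.1 s) (IccExtend zero_le_one z.2 s)
      = IccExtend zero_le_one (F z) s := fun s hs => by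
    simp only [IccExtend_of_mem _ _ hs, hF]
  have hgG : ∀ s ∈ Icc (0 : ℝ) 1, g s (IccExtend zero_le_one z.1 s) (IccExtend zero_le_one z.2 s)
      = IccExtend zero_le_one (G z) s := fun s hs => by
    simp only [IccExtend_of_mem _ _ hs, hG]
  rw [Tmap_congr hfF hη ht, Tmap_congr hgG hξ ht, ← hJ₁ (F z) ⟨t, ht⟩, ← hJ₂ (G z) ⟨t, ht⟩,
    IccExtend_of_mem _ _ ht, IccExtend_of_mem _ _ ht]
  exact ⟨congrArg (fun w => w.1 ⟨t, ht⟩) hz.symm, congrArg (fun w => w.2 ⟨t, ht⟩) hz.symm⟩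
end
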